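/- arXiv:0912.1912 — 2 statements merged into one kernel-verified Lean document; each statement's English description precedes it below -/
import Mathlib

section
/- For all p ∈ [1,+∞) and r,s ∈ [1,2] with s ≤ r, E(L_r,p) is Borel reducible to E(L_s,p). -/
open Filter Topology MeasureTheory
open scoped ENNReal NNReal

noncomputable section

/-- `E` is Borel reducible to `F`: there is a Borel (measurable) map `θ` such that
`E x y ↔ F (θ x) (θ y)` for all `x, y`. -/
def BorelReducible {α β : Type*} [MeasurableSpace α] [MeasurableSpace β]
    (E : α → α → Prop) (F : β → β → Prop) : Prop :=
  ∃ θ : α → β, Measurable θ ∧ ∀ x y, E x y ↔ F (θ x) (θ y)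

/-- The sequence space `ℓ_r` of real sequences with summable `r`-th power. -/
abbrev ellSp (r : ℝ) : Type := lp (fun _ : ℕ => ℝ) (ENNReal.ofReal r)

/-- The Lebesgue space `L_r[0,1]` (with respect to Lebesgue measure on `[0,1]`). -/
abbrev LSp (r : ℝ) : Type :=
  MeasureTheory.Lp ℝ (ENNReal.ofReal r) ((volume : Measure ℝ).restrict (Set.Icc 0 1))

/-- The equivalence relation `E(X,p)` on `X^ℕ`:
`x ~ y` iff `Σ_n ‖x n - y n‖^p < ∞`. -/
def ESum (X : Type*) [NormedAddCommGroup X] (p : ℝ) : (ℕ → X) → (ℕ → X) → Prop :=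
  fun x y => Summable fun n => ‖x n - y n‖ ^ p

noncomputable instance {E : ℕ → Type*} [∀ i, NormedAddCommGroup (E i)] (p : ℝ≥0∞)
    [Fact (1 ≤ p)] : MeasurableSpace (lp E p) := borel _
instance {E : ℕ → Type*} [∀ i, NormedAddCommGroup (E i)] (p : ℝ≥0∞)
    [Fact (1 ≤ p)] : BorelSpace (lp E p) := ⟨rfl⟩

noncomputable instance {α : Type*} [MeasurableSpace α] (μ : Measure α) (p : ℝ≥0∞)
    [Fact (1 ≤ p)] : MeasurableSpace (Lp ℝ p μ) := borel _
instance {α : Type*} [MeasurableSpace α] (μ : Measure α) (p : ℝ≥0∞)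
    [Fact (1 ≤ p)] : BorelSpace (Lp ℝ p μ) := ⟨rfl⟩

instance : Fact (1 ≤ ENNReal.ofReal 2) := ⟨ENNReal.one_le_ofReal.2 one_le_two⟩

section mine
open ProbabilityTheory

def phiF (s x : ℝ) : ℝ := min (x ^ 2) (|x| ^ s)

lemma phiF_nonneg (s x : ℝ) : 0 ≤ phiF s x := le_min (sq_nonneg x) (by positivity)

lemma phiF_neg (s x : ℝ) : phiF s (-x) = phiF s x := by simp [phiF]

lemma phiF_meas (s : ℝ) : Measurable (phiF s) := by
  unfold phiF
  exact (measurable_id.pow_const 2).min ((continuous_abs.measurable).pow_const s)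

lemma phiF_step {s : ℝ} (hs : 1 ≤ s) (hs2 : s ≤ 2) (a b : ℝ) :
    phiF s (a + b) + phiF s (a - b) ≤ 2 * (phiF s a + phiF s b) := by
  have key : ∀ x : ℝ, |x| ^ s = (x ^ 2) ^ (s / 2) := by
    intro x
    rw [← sq_abs, ← Real.rpow_natCast, ← Real.rpow_mul (abs_nonneg x)]
    congr 1
    push_cast; ring
  have e1 : phiF s (a + b) + phiF s (a - b) ≤
      2 * min (a ^ 2 + b ^ 2) ((a ^ 2 + b ^ 2) ^ (s / 2)) := by
    rw [mul_min_of_nonneg _ _ (by norm_num : (0:ℝ) ≤ 2)]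
    apply le_min
    · calc _ ≤ (a + b) ^ 2 + (a - b) ^ 2 := add_le_add (min_le_left _ _) (min_le_left _ _)
        _ = _ := by ring
    · have h0 := (Real.concaveOn_rpow (p := s / 2) (by linarith) (by linarith)).2
      have h1 := @h0 ((a + b) ^ 2) (Set.mem_Ici.2 (sq_nonneg _)) ((a - b) ^ 2)
        (Set.mem_Ici.2 (sq_nonneg _))
        (1 / 2) (1 / 2) (by norm_num) (by norm_num) (by norm_num)
      simp only [smul_eq_mul] at h1
      have h2 : 1 / 2 * (a + b) ^ 2 + 1 / 2 * (a - b) ^ 2 = a ^ 2 + b ^ 2 := by ring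
      rw [h2] at h1
      calc _ ≤ |a + b| ^ s + |a - b| ^ s := add_le_add (min_le_right _ _) (min_le_right _ _)
        _ ≤ _ := by rw [key, key]; linarith
  refine e1.trans ?_
  gcongr
  -- subadditivity
  have mono : ∀ x y : ℝ, x ^ 2 * min 1 ((x ^ 2 + y ^ 2) ^ (s / 2 - 1)) ≤ phiF s x := by
    intro x y
    rcases eq_or_ne x 0 with rfl | hx
    · simpa using phiF_nonneg s 0
    have hx2 : 0 < x ^ 2 := by positivity
    rw [mul_min_of_nonneg _ _ hx2.le, mul_one]
    refine min_le_min le_rfl ?_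
    rw [key]
    calc x ^ 2 * (x ^ 2 + y ^ 2) ^ (s / 2 - 1) ≤ x ^ 2 * (x ^ 2) ^ (s / 2 - 1) := by
          gcongr x ^ 2 * ?_
          exact Real.rpow_le_rpow_of_nonpos hx2 (by nlinarith [sq_nonneg y]) (by linarith)
      _ = (x ^ 2) ^ (s / 2) := by
          rw [Real.rpow_sub_one hx2.ne']; field_simp
  have h1 := mono a b
  have h2 := mono b a
  rw [add_comm (b ^ 2)] at h2
  have h3 : min (a ^ 2 + b ^ 2) ((a ^ 2 + b ^ 2) ^ (s / 2)) =
      (a ^ 2 + b ^ 2) * min 1 ((a ^ 2 + b ^ 2) ^ (s / 2 - 1)) := by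
    rcases eq_or_ne (a ^ 2 + b ^ 2) 0 with h | h
    · rw [h, Real.zero_rpow (by linarith)]; simp
    rw [mul_min_of_nonneg _ _ (by positivity), mul_one, Real.rpow_sub_one h]
    field_simp
  rw [h3, add_mul]
  exact add_le_add h1 h2

lemma phiF_bound {s : ℝ} (hs : 1 ≤ s) (hs2 : s ≤ 2) {d : ℝ} (hd : 0 < d) (hd1 : d ≤ 1) (x : ℝ) :
    |x| ^ s ≤ d ^ s + d ^ (s - 2) * phiF s x := by
  rcases le_or_gt |x| d with h | h
  · have : |x| ^ s ≤ d ^ s := Real.rpow_le_rpow (abs_nonneg x) h (by linarith)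
    have h2 : 0 ≤ d ^ (s - 2) * phiF s x := mul_nonneg (by positivity) (phiF_nonneg s x)
    linarith
  · have hx : 0 < |x| := hd.trans h
    have h0 : 0 ≤ d ^ s := by positivity
    have : |x| ^ s ≤ d ^ (s - 2) * phiF s x := by
      unfold phiF
      rw [mul_min_of_nonneg _ _ (by positivity)]
      apply le_min
      · rw [← sq_abs]
        calc |x| ^ s = |x| ^ (s - 2) * |x| ^ 2 := by
              rw [← Real.rpow_natCast |x| 2, ← Real.rpow_add hx]; congr 1; push_cast; ring
          _ ≤ _ := by
              gcongr ?_ * _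
              exact Real.rpow_le_rpow_of_nonpos hd h.le (by linarith)
      · exact le_mul_of_one_le_left (by positivity)
          (Real.one_le_rpow_of_pos_of_le_one_of_nonpos hd hd1 (by linarith))
    linarith

section prob
variable {Ω : Type*} [MeasurableSpace Ω] {P : Measure Ω} [IsProbabilityMeasure P]

lemma sym_law {S X : Ω → ℝ} (hS : Measurable S) (hX : Measurable X) (hi : IndepFun S X P)
    (hsym : P.map (fun ω => - X ω) = P.map X) :
    P.map (fun ω => (S ω, - X ω)) = P.map (fun ω => (S ω, X ω)) := by
  have hi2 : IndepFun S (fun ω => - X ω) P := hi.comp measurable_id measurable_neg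
  rw [hi.map_prod_eq_prod_map_map hS.aemeasurable hX.aemeasurable,
    hi2.map_prod_eq_prod_map_map hS.aemeasurable (by fun_prop), hsym]

lemma phi_one_step {s : ℝ} (hs : 1 ≤ s) (hs2 : s ≤ 2) {S X : Ω → ℝ} (hS : Measurable S)
    (hX : Measurable X) (hi : IndepFun S X P) (hsym : P.map (fun ω => - X ω) = P.map X) :
    ∫⁻ ω, ENNReal.ofReal (phiF s (S ω + X ω)) ∂P ≤
      ∫⁻ ω, ENNReal.ofReal (phiF s (S ω)) ∂P + ∫⁻ ω, ENNReal.ofReal (phiF s (X ω)) ∂P := by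
  have hm := phiF_meas s
  have hl := sym_law hS hX hi hsym
  have hF : Measurable (fun z : ℝ × ℝ => ENNReal.ofReal (phiF s (z.1 + z.2))) := by fun_prop
  have h1 : ∫⁻ ω, ENNReal.ofReal (phiF s (S ω + X ω)) ∂P =
      ∫⁻ ω, ENNReal.ofReal (phiF s (S ω - X ω)) ∂P := by
    have e1 := lintegral_map (μ := P) hF (hS.prodMk hX)
    have e2 := lintegral_map (μ := P) hF (hS.prodMk hX.neg)
    simp only [Pi.neg_apply, ← sub_eq_add_neg] at e2
    rw [← e1, ← e2]
    congr 1
    exact hl.symm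
  have h2 : 2 * ∫⁻ ω, ENNReal.ofReal (phiF s (S ω + X ω)) ∂P ≤
      2 * (∫⁻ ω, ENNReal.ofReal (phiF s (S ω)) ∂P + ∫⁻ ω, ENNReal.ofReal (phiF s (X ω)) ∂P) := by
    rw [two_mul]
    nth_rewrite 2 [h1]
    rw [← lintegral_add_left (by fun_prop), ← lintegral_add_left (by fun_prop),
      ← lintegral_const_mul _ (by fun_prop)]
    apply lintegral_mono
    intro ω
    dsimp only
    rw [← ENNReal.ofReal_add (phiF_nonneg _ _) (phiF_nonneg _ _),
      ← ENNReal.ofReal_add (phiF_nonneg _ _) (phiF_nonneg _ _),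
      show (2:ℝ≥0∞) = ENNReal.ofReal 2 by simp, ← ENNReal.ofReal_mul (by norm_num)]
    exact ENNReal.ofReal_le_ofReal (phiF_step hs hs2 _ _)
  exact (ENNReal.mul_le_mul_iff_right (by norm_num) (by norm_num)).1 h2

lemma cos_one_step {S X : Ω → ℝ} (hS : Measurable S)
    (hX : Measurable X) (hi : IndepFun S X P) (hsym : P.map (fun ω => - X ω) = P.map X) :
    ∫ ω, Real.cos (S ω + X ω) ∂P = (∫ ω, Real.cos (S ω) ∂P) * ∫ ω, Real.cos (X ω) ∂P := by
  have hl := sym_law hS hX hi hsym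
  have hint : ∀ Y : Ω → ℝ, Measurable Y → Integrable (fun ω => Real.cos (Y ω)) P := by
    intro Y hY
    refine Integrable.of_bound (C := 1) (by fun_prop) (ae_of_all _ fun ω => ?_)
    simpa using Real.abs_cos_le_one _
  have hF : Continuous (fun z : ℝ × ℝ => Real.cos (z.1 + z.2)) := by fun_prop
  have h1 : ∫ ω, Real.cos (S ω + X ω) ∂P = ∫ ω, Real.cos (S ω - X ω) ∂P := by
    have e1 := integral_map (μ := P) (hS.prodMk hX).aemeasurable hF.aestronglyMeasurable
    have e2 := integral_map (μ := P) (hS.prodMk hX.neg).aemeasurable hF.aestronglyMeasurable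
    simp only [Pi.neg_apply, ← sub_eq_add_neg] at e2
    rw [← e1, ← e2]
    congr 1
    exact hl.symm
  have h2 : ∫ ω, Real.cos (S ω) * Real.cos (X ω) ∂P =
      (∫ ω, Real.cos (S ω) ∂P) * ∫ ω, Real.cos (X ω) ∂P :=
    (hi.comp Real.measurable_cos Real.measurable_cos).integral_mul_eq_mul_integral
      (by fun_prop) (by fun_prop)
  rw [← h2]
  have h3 : ∫ ω, Real.cos (S ω + X ω) ∂P + ∫ ω, Real.cos (S ω - X ω) ∂P =
      2 * ∫ ω, Real.cos (S ω) * Real.cos (X ω) ∂P := by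
    rw [← integral_add (hint _ (by fun_prop)) (hint _ (by fun_prop)), ← integral_const_mul]
    congr 1; ext ω
    rw [Real.cos_add, Real.cos_sub]; ring
  linarith

lemma phi_sum {s : ℝ} (hs : 1 ≤ s) (hs2 : s ≤ 2) {X : ℕ → Ω → ℝ} (hX : ∀ j, Measurable (X j))
    (hi : iIndepFun X P) (hsym : ∀ j, P.map (fun ω => - X j ω) = P.map (X j)) (F : Finset ℕ) :
    ∫⁻ ω, ENNReal.ofReal (phiF s (∑ j ∈ F, X j ω)) ∂P ≤
      ∑ j ∈ F, ∫⁻ ω, ENNReal.ofReal (phiF s (X j ω)) ∂P := by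
  classical
  induction F using Finset.induction_on with
  | empty => simp [phiF]
  | insert a F ha ih =>
    have hind := hi.indepFun_finsetSum_of_notMem hX ha
    have := phi_one_step hs hs2 (S := ∑ j ∈ F, X j) (by fun_prop)
      (hX a) hind (hsym a)
    simp only [Finset.sum_apply] at this
    rw [Finset.sum_insert ha, add_comm]
    simp_rw [Finset.sum_insert ha, add_comm (X a _)]
    exact this.trans (by gcongr)

lemma cos_sum {X : ℕ → Ω → ℝ} (hX : ∀ j, Measurable (X j))
    (hi : iIndepFun X P) (hsym : ∀ j, P.map (fun ω => - X j ω) = P.map (X j)) (F : Finset ℕ) :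
    ∫ ω, Real.cos (∑ j ∈ F, X j ω) ∂P = ∏ j ∈ F, ∫ ω, Real.cos (X j ω) ∂P := by
  classical
  induction F using Finset.induction_on with
  | empty => simp
  | insert a F ha ih =>
    have hind := hi.indepFun_finsetSum_of_notMem hX ha
    have := cos_one_step (S := ∑ j ∈ F, X j) (by fun_prop)
      (hX a) hind (hsym a)
    simp only [Finset.sum_apply] at this
    rw [Finset.prod_insert ha, mul_comm, ← ih]
    simp_rw [Finset.sum_insert ha, add_comm (X a _)]
    exact this

end prob

section core
variable {Ω : Type*} [MeasurableSpace Ω] {P : Measure Ω}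

lemma lp_norm_pow {s : ℝ} (hs : 1 ≤ s) [Fact (1 ≤ ENNReal.ofReal s)]
    (f : Lp ℝ (ENNReal.ofReal s) P) :
    ENNReal.ofReal (‖f‖ ^ s) = ∫⁻ ω, ENNReal.ofReal (|f ω| ^ s) ∂P := by
  have h0 : 0 < s := by linarith
  have hne : eLpNorm f (ENNReal.ofReal s) P ≠ ∞ := Lp.eLpNorm_ne_top f
  rw [← ENNReal.ofReal_rpow_of_nonneg (norm_nonneg _) h0.le, Lp.norm_def, ENNReal.ofReal_toReal hne,
    eLpNorm_eq_lintegral_rpow_enorm_toReal (by simpa using h0) (by simp),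
    ENNReal.toReal_ofReal h0.le, ← ENNReal.rpow_mul, one_div, inv_mul_cancel₀ h0.ne',
    ENNReal.rpow_one]
  congr 1; ext ω
  rw [← ENNReal.ofReal_rpow_of_nonneg (abs_nonneg _) h0.le, ← Real.norm_eq_abs, ofReal_norm]

lemma one_sub_cos_le {s : ℝ} (hs : 1 ≤ s) (hs2 : s ≤ 2) (x : ℝ) :
    1 - Real.cos x ≤ 2 * |x| ^ s := by
  rcases le_or_gt |x| 1 with h | h
  · have h1 := Real.one_sub_sq_div_two_le_cos (x := x)
    rcases eq_or_ne x 0 with rfl | hx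
    · simp; positivity
    have h2 : |x| ^ (2:ℝ) ≤ |x| ^ s :=
      Real.rpow_le_rpow_of_exponent_ge (abs_pos.2 hx) h hs2
    rw [Real.rpow_two, sq_abs] at h2
    nlinarith [sq_nonneg x]
  · have h2 : 1 ≤ |x| ^ s := Real.one_le_rpow h.le (by linarith)
    linarith [Real.neg_one_le_cos x]

variable [IsProbabilityMeasure P]

lemma lp_norm_bound {s : ℝ} (hs : 1 ≤ s) (hs2 : s ≤ 2) [Fact (1 ≤ ENNReal.ofReal s)]
    {d : ℝ} (hd : 0 < d) (hd1 : d ≤ 1) (f : Lp ℝ (ENNReal.ofReal s) P) :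
    ENNReal.ofReal (‖f‖ ^ s) ≤ ENNReal.ofReal (d ^ s) +
      ENNReal.ofReal (d ^ (s - 2)) * ∫⁻ ω, ENNReal.ofReal (phiF s (f ω)) ∂P := by
  rw [lp_norm_pow hs]
  have hm : Measurable f := (Lp.stronglyMeasurable f).measurable
  have hp := phiF_meas s
  calc _ ≤ ∫⁻ ω, (ENNReal.ofReal (d ^ s) +
        ENNReal.ofReal (d ^ (s - 2)) * ENNReal.ofReal (phiF s (f ω))) ∂P := by
        apply lintegral_mono
        intro ω
        dsimp only
        rw [← ENNReal.ofReal_mul (by positivity), ← ENNReal.ofReal_add (by positivity)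
          (mul_nonneg (by positivity) (phiF_nonneg _ _))]
        exact ENNReal.ofReal_le_ofReal (phiF_bound hs hs2 hd hd1 _)
    _ = _ := by
        rw [lintegral_add_left (by fun_prop), lintegral_const_mul _ (by fun_prop)]
        simp

theorem core {V : Type*} [NormedAddCommGroup V] [NormedSpace ℝ V] {s : ℝ} (hs : 1 ≤ s)
    (hs2 : s ≤ 2) [Fact (1 ≤ ENNReal.ofReal s)] (Z : ℕ → V →ₗ[ℝ] Lp ℝ (ENNReal.ofReal s) P)
    (hind : ∀ v, iIndepFun (fun j => (Z j v : Ω → ℝ)) P)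
    (hsym : ∀ v j, P.map (fun ω => - Z j v ω) = P.map (Z j v))
    (K : ℝ → ℝ)
    (hup : ∀ v, ∑' j, ∫⁻ ω, ENNReal.ofReal (phiF s (Z j v ω)) ∂P ≤ ENNReal.ofReal (K ‖v‖))
    (t η : ℝ) (ht : 0 < t) (hη : 0 < η)
    (hlo1 : ∀ v, ‖v‖ = t → ∀ j, ∫⁻ ω, ENNReal.ofReal (1 - Real.cos (Z j v ω)) ∂P ≤ 1)
    (hlo2 : ∀ v, ‖v‖ = t →
      ENNReal.ofReal η ≤ ∑' j, ∫⁻ ω, ENNReal.ofReal (1 - Real.cos (Z j v ω)) ∂P) :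
    ∃ T : V → Lp ℝ (ENNReal.ofReal s) P, ∃ c C : ℝ, 0 < c ∧ 0 < C ∧
      ∀ v w, c * ‖v - w‖ ≤ ‖T v - T w‖ ∧ ‖T v - T w‖ ≤ C * ‖v - w‖ := by
  have hs0 : 0 < s := by linarith
  have hZm : ∀ v j, Measurable (Z j v) := fun v j => (Lp.stronglyMeasurable (Z j v)).measurable
  have hcoe : ∀ v (F : Finset ℕ), ∀ᵐ ω ∂P, (∑ j ∈ F, Z j v : Lp ℝ (ENNReal.ofReal s) P) ω =
      ∑ j ∈ F, Z j v ω := by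
    intro v F
    filter_upwards [Lp.coeFn_finsetSum F (fun j => Z j v)] with ω hω
    rw [hω]; simp
  have hB : ∀ v (F : Finset ℕ),
      ∫⁻ ω, ENNReal.ofReal (phiF s ((∑ j ∈ F, Z j v : Lp ℝ (ENNReal.ofReal s) P) ω)) ∂P ≤
      ∑ j ∈ F, ∫⁻ ω, ENNReal.ofReal (phiF s (Z j v ω)) ∂P := by
    intro v F
    refine le_trans (le_of_eq ?_) (phi_sum hs hs2 (hZm v) (hind v) (hsym v) F)
    apply lintegral_congr_ae
    filter_upwards [hcoe v F] with ω hω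
    rw [hω]
  have hsummable : ∀ v, Summable (fun j => Z j v) := by
    intro v
    have hne : ∑' j, ∫⁻ ω, ENNReal.ofReal (phiF s (Z j v ω)) ∂P ≠ ∞ :=
      ((hup v).trans_lt ENNReal.ofReal_lt_top).ne
    have hne' := fun j => ENNReal.ne_top_of_tsum_ne_top hne j
    have hsr := ENNReal.summable_toReal hne
    rw [summable_iff_vanishing_norm]
    intro ε hε
    obtain ⟨d, hd, hd1, hdε⟩ : ∃ d : ℝ, 0 < d ∧ d ≤ 1 ∧ d < ε / 2 :=
      ⟨min 1 (ε / 4), by positivity, min_le_left _ _,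
        (min_le_right _ _).trans_lt (by linarith)⟩
    have h2 : d ^ s + d ^ s ≤ (2 * d) ^ s := by
      rw [Real.mul_rpow (by norm_num) hd.le, ← two_mul]
      gcongr
      calc (2:ℝ) = 2 ^ (1:ℝ) := by simp
        _ ≤ 2 ^ s := Real.rpow_le_rpow_of_exponent_le (by norm_num) hs
    obtain ⟨F0, hF0⟩ := summable_iff_vanishing_norm.1 hsr (d ^ 2) (by positivity)
    refine ⟨F0, fun F hF => ?_⟩
    have h3 := hF0 F hF
    rw [Real.norm_of_nonneg (Finset.sum_nonneg fun _ _ => ENNReal.toReal_nonneg)] at h3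
    have h4 : ∑ j ∈ F, ∫⁻ ω, ENNReal.ofReal (phiF s (Z j v ω)) ∂P ≤ ENNReal.ofReal (d ^ 2) := by
      rw [← ENNReal.toReal_sum fun j _ => hne' j] at h3
      exact (ENNReal.le_ofReal_iff_toReal_le (ENNReal.sum_ne_top.2 fun j _ => hne' j)
        (by positivity)).2 h3.le
    have h5 := lp_norm_bound hs hs2 hd hd1 (∑ j ∈ F, Z j v)
    have h6 : ENNReal.ofReal (‖∑ j ∈ F, Z j v‖ ^ s) ≤ ENNReal.ofReal (d ^ s + d ^ s) := by
      refine h5.trans ?_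
      rw [ENNReal.ofReal_add (by positivity) (by positivity)]
      gcongr
      refine (mul_le_mul_right ((hB v F).trans h4) _).trans ?_
      rw [← ENNReal.ofReal_mul (by positivity)]
      apply ENNReal.ofReal_le_ofReal
      rw [← Real.rpow_natCast d 2, ← Real.rpow_add hd]
      simp
    rw [ENNReal.ofReal_le_ofReal_iff (by positivity)] at h6
    have h7 := (Real.rpow_le_rpow_iff (norm_nonneg _) (by positivity) hs0).1 (h6.trans h2)
    linarith
  set T : V → Lp ℝ (ENNReal.ofReal s) P := fun v => ∑' j, Z j v with hT
  have hTsub : ∀ v w, T v - T w = T (v - w) := by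
    intro v w
    simp only [hT, map_sub]
    exact ((hsummable v).tsum_sub (hsummable w)).symm
  have hTsmul : ∀ (a : ℝ) v, T (a • v) = a • T v := by
    intro a v
    simp only [hT, map_smul]
    exact (hsummable v).tsum_const_smul a
  have hTlim : ∀ v, Tendsto (fun F : Finset ℕ => ‖∑ j ∈ F, Z j v‖) atTop (𝓝 ‖T v‖) :=
    fun v => (hsummable v).hasSum.norm
  set C : ℝ := (1 + |K 1|) ^ (1 / s) with hC
  have hCpos : 0 < C := by positivity
  have hU : ∀ v, ‖v‖ = 1 → ‖T v‖ ≤ C := by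
    intro v hv
    refine le_of_tendsto (hTlim v) (Eventually.of_forall fun F => ?_)
    have h5 := lp_norm_bound hs hs2 one_pos le_rfl (∑ j ∈ F, Z j v)
    simp only [Real.one_rpow, ENNReal.ofReal_one, one_mul] at h5
    have h6 : ENNReal.ofReal (‖∑ j ∈ F, Z j v‖ ^ s) ≤ ENNReal.ofReal (1 + |K 1|) := by
      refine h5.trans ?_
      rw [ENNReal.ofReal_add (by positivity) (by positivity), ENNReal.ofReal_one]
      gcongr
      refine (hB v F).trans ((ENNReal.sum_le_tsum F).trans ((hup v).trans ?_))
      rw [hv]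
      exact ENNReal.ofReal_le_ofReal (le_abs_self _)
    rw [ENNReal.ofReal_le_ofReal_iff (by positivity)] at h6
    rw [hC, one_div, Real.le_rpow_inv_iff_of_pos (norm_nonneg _) (by positivity) hs0]
    exact h6
  set e : ℝ := (1 - Real.exp (-(η / 2))) / 2 with he
  have hepos : 0 < e := by
    have : Real.exp (-(η / 2)) < 1 := by
      rw [← Real.exp_zero]; exact Real.exp_lt_exp.2 (by linarith)
    rw [he]; linarith
  set c : ℝ := e ^ (1 / s) with hc
  have hcpos : 0 < c := by positivity
  have hL : ∀ v, ‖v‖ = t → c ≤ ‖T v‖ := by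
    intro v hv
    have hci : ∀ f : Ω → ℝ, Measurable f → Integrable (fun ω => Real.cos (f ω)) P := by
      intro f hf
      refine Integrable.of_bound (C := 1) (by fun_prop) (ae_of_all _ fun ω => ?_)
      simpa using Real.abs_cos_le_one _
    have hlt : ENNReal.ofReal (η / 2) <
        ∑' j, ∫⁻ ω, ENNReal.ofReal (1 - Real.cos (Z j v ω)) ∂P :=
      lt_of_lt_of_le ((ENNReal.ofReal_lt_ofReal_iff hη).2 (by linarith)) (hlo2 v hv)
    have hev := (ENNReal.summable.hasSum
      (f := fun j => ∫⁻ ω, ENNReal.ofReal (1 - Real.cos (Z j v ω)) ∂P)).eventually_const_lt hlt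
    refine ge_of_tendsto (hTlim v) ?_
    filter_upwards [hev] with F hF
    have hδ : ∀ f : Ω → ℝ, Measurable f → ∫⁻ ω, ENNReal.ofReal (1 - Real.cos (f ω)) ∂P =
        ENNReal.ofReal (1 - ∫ ω, Real.cos (f ω) ∂P) := by
      intro f hf
      have hi1 : Integrable (fun ω => 1 - Real.cos (f ω)) P := (integrable_const _).sub (hci f hf)
      rw [← ofReal_integral_eq_lintegral_ofReal hi1
        (ae_of_all _ fun ω => by simpa using Real.cos_le_one _),
        integral_sub (integrable_const _) (hci f hf)]
      simp
    have hcosle : ∀ f : Ω → ℝ, Measurable f → ∫ ω, Real.cos (f ω) ∂P ≤ 1 := by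
      intro f hf
      calc _ ≤ ∫ ω, (1:ℝ) ∂P := integral_mono (hci f hf) (integrable_const _)
            (fun ω => Real.cos_le_one _)
        _ = 1 := by simp
    have hcos0 : ∀ j, 0 ≤ ∫ ω, Real.cos (Z j v ω) ∂P := by
      intro j
      have := hlo1 v hv j
      rw [hδ _ (hZm v j), ENNReal.ofReal_le_one] at this
      linarith
    have hsum : η / 2 < ∑ j ∈ F, (1 - ∫ ω, Real.cos (Z j v ω) ∂P) := by
      have : ∑ j ∈ F, ∫⁻ ω, ENNReal.ofReal (1 - Real.cos (Z j v ω)) ∂P =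
          ENNReal.ofReal (∑ j ∈ F, (1 - ∫ ω, Real.cos (Z j v ω) ∂P)) := by
        rw [ENNReal.ofReal_sum_of_nonneg (fun j _ => by linarith [hcosle _ (hZm v j)])]
        exact Finset.sum_congr rfl fun j _ => hδ _ (hZm v j)
      rw [this] at hF
      exact (ENNReal.ofReal_lt_ofReal_iff_of_nonneg (by linarith)).1 hF
    have hprod : ∏ j ∈ F, ∫ ω, Real.cos (Z j v ω) ∂P ≤ Real.exp (-(η / 2)) := by
      calc _ ≤ ∏ j ∈ F, Real.exp (-(1 - ∫ ω, Real.cos (Z j v ω) ∂P)) := by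
            refine Finset.prod_le_prod (fun j _ => hcos0 j) fun j _ => ?_
            have := Real.add_one_le_exp (-(1 - ∫ ω, Real.cos (Z j v ω) ∂P))
            linarith
        _ = Real.exp (-∑ j ∈ F, (1 - ∫ ω, Real.cos (Z j v ω) ∂P)) := by
            rw [← Real.exp_sum, Finset.sum_neg_distrib]
        _ ≤ _ := Real.exp_le_exp.2 (by linarith)
    rw [← cos_sum (hZm v) (hind v) (hsym v) F] at hprod
    have h1 : ENNReal.ofReal (2 * e) ≤ ENNReal.ofReal (2 * ‖∑ j ∈ F, Z j v‖ ^ s) := by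
      calc ENNReal.ofReal (2 * e)
          ≤ ENNReal.ofReal (1 - ∫ ω, Real.cos (∑ j ∈ F, Z j v ω) ∂P) :=
            ENNReal.ofReal_le_ofReal (by rw [he]; linarith)
        _ = ∫⁻ ω, ENNReal.ofReal (1 - Real.cos (∑ j ∈ F, Z j v ω)) ∂P :=
            (hδ _ (Finset.measurable_sum F fun j _ => hZm v j)).symm
        _ ≤ ∫⁻ ω, ENNReal.ofReal 2 * ENNReal.ofReal
              (|(∑ j ∈ F, Z j v : Lp ℝ (ENNReal.ofReal s) P) ω| ^ s) ∂P := by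
            apply lintegral_mono_ae
            filter_upwards [hcoe v F] with ω hω
            rw [hω, ← ENNReal.ofReal_mul (by norm_num)]
            exact ENNReal.ofReal_le_ofReal (one_sub_cos_le hs hs2 _)
        _ = _ := by
            rw [lintegral_const_mul' _ _ (by simp), ← lp_norm_pow hs,
              ENNReal.ofReal_mul (by norm_num)]
    rw [ENNReal.ofReal_le_ofReal_iff (by positivity)] at h1
    rw [hc, one_div, Real.rpow_inv_le_iff_of_pos hepos.le (norm_nonneg _) hs0]
    linarith
  refine ⟨T, c / t, C, by positivity, hCpos, fun v w => ?_⟩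
  rw [hTsub]
  generalize v - w = u
  rcases eq_or_ne u 0 with rfl | hu
  · have : T 0 = 0 := by simp [hT]
    simp [this]
  have hu' : 0 < ‖u‖ := norm_pos_iff.2 hu
  constructor
  · have h := hL ((t / ‖u‖) • u) (by
      rw [norm_smul, Real.norm_of_nonneg (by positivity)]; field_simp)
    rw [hTsmul, norm_smul, Real.norm_of_nonneg (by positivity)] at h
    rw [div_mul_eq_mul_div, div_le_iff₀ ht]
    rw [div_mul_eq_mul_div, le_div_iff₀ hu'] at h
    linarith
  · have h := hU ((1 / ‖u‖) • u) (by
      rw [norm_smul, Real.norm_of_nonneg (by positivity)]; field_simp)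
    rw [hTsmul, norm_smul, Real.norm_of_nonneg (by positivity)] at h
    rw [div_mul_eq_mul_div, div_le_iff₀ hu'] at h
    linarith

end core

section iid

abbrev muI : Measure ℝ := (volume : Measure ℝ).restrict (Set.Icc 0 1)

instance muI_prob : IsProbabilityMeasure muI := ⟨by simp [muI]⟩

def rhoB : Measure Bool := (2⁻¹ : ℝ≥0∞) • (Measure.dirac true + Measure.dirac false)

instance rhoB_prob : IsProbabilityMeasure rhoB := ⟨by
  simp [rhoB]
  exact ENNReal.inv_two_add_inv_two⟩

lemma rhoB_not : MeasurePreserving (fun b : Bool => !b) rhoB rhoB := by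
  refine ⟨measurable_of_countable _, ?_⟩
  have hm : Measurable (fun b : Bool => !b) := measurable_of_countable _
  rw [rhoB, Measure.map_smul, Measure.map_add _ _ hm, Measure.map_dirac' hm, Measure.map_dirac' hm]
  simp [add_comm]

lemma exists_iid_W : ∃ W : ℕ → ℝ → ℝ × Bool, (∀ j, MeasurePreserving (W j) muI (muI.prod rhoB)) ∧
    iIndepFun W muI := by
  obtain ⟨f, hf, hfm⟩ := MeasureTheory.Measure.exists_measurable_map_eq
    (Measure.infinitePi (fun _ : ℕ => muI.prod rhoB))
  set pr : ℝ → unitInterval := Set.projIcc (0:ℝ) 1 zero_le_one with hpr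
  have hprm : Measurable pr := (continuous_projIcc).measurable
  have hprmap : muI.map pr = volume := by
    have h1 : muI = (volume : Measure unitInterval).map ((↑) : unitInterval → ℝ) :=
      (map_comap_subtype_coe measurableSet_Icc volume).symm
    rw [h1, Measure.map_map hprm measurable_subtype_coe]
    have : pr ∘ ((↑) : unitInterval → ℝ) = id := by
      ext x; simp [hpr]
    rw [this, Measure.map_id]
  have hmap : muI.map (fun ω => f (pr ω)) = Measure.infinitePi (fun _ : ℕ => muI.prod rhoB) := by
    rw [← hfm, ← hprmap, Measure.map_map hf hprm]; rfl
  have hmp : ∀ j, MeasurePreserving (fun ω => f (pr ω) j) muI (muI.prod rhoB) := by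
    intro j
    have h1 : MeasurePreserving (fun ω => f (pr ω)) muI
        (Measure.infinitePi (fun _ : ℕ => muI.prod rhoB)) := ⟨hf.comp hprm, hmap⟩
    exact (measurePreserving_eval_infinitePi (fun _ : ℕ => muI.prod rhoB) j).comp h1
  refine ⟨fun j ω => f (pr ω) j, hmp, ?_⟩
  rw [iIndepFun_iff_map_fun_eq_infinitePi_map (fun j => (hmp j).measurable)]
  simp_rw [fun j => (hmp j).map_eq]
  exact hmap

def sgB (b : Bool) : ℝ := if b then 1 else -1

lemma sgB_cases (b : Bool) : sgB b = 1 ∨ sgB b = -1 := by cases b <;> simp [sgB]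

lemma sgB_not (b : Bool) : sgB (!b) = - sgB b := by cases b <;> simp [sgB]

theorem core2 {V : Type*} [NormedAddCommGroup V] [NormedSpace ℝ V] {s : ℝ} (hs : 1 ≤ s)
    (hs2 : s ≤ 2) [Fact (1 ≤ ENNReal.ofReal s)] (A : ℕ → V →ₗ[ℝ] Lp ℝ (ENNReal.ofReal s) muI)
    (K : ℝ → ℝ)
    (hup : ∀ v, ∑' j, ∫⁻ ω, ENNReal.ofReal (phiF s (A j v ω)) ∂muI ≤ ENNReal.ofReal (K ‖v‖))
    (t η : ℝ) (ht : 0 < t) (hη : 0 < η)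
    (hlo1 : ∀ v, ‖v‖ = t → ∀ j, ∫⁻ ω, ENNReal.ofReal (1 - Real.cos (A j v ω)) ∂muI ≤ 1)
    (hlo2 : ∀ v, ‖v‖ = t →
      ENNReal.ofReal η ≤ ∑' j, ∫⁻ ω, ENNReal.ofReal (1 - Real.cos (A j v ω)) ∂muI) :
    ∃ T : V → Lp ℝ (ENNReal.ofReal s) muI, ∃ c C : ℝ, 0 < c ∧ 0 < C ∧
      ∀ v w, c * ‖v - w‖ ≤ ‖T v - T w‖ ∧ ‖T v - T w‖ ≤ C * ‖v - w‖ := by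
  obtain ⟨W, hW, hWi⟩ := exists_iid_W
  have hAm : ∀ v j, Measurable (A j v) := fun v j => (Lp.stronglyMeasurable (A j v)).measurable
  have hsgm : Measurable sgB := measurable_of_countable _
  have hU : ∀ j, MeasurePreserving (fun ω => (W j ω).1) muI muI := fun j =>
    measurePreserving_fst.comp (hW j)
  set G : ℕ → V → ℝ × Bool → ℝ := fun j v b => sgB b.2 * A j v b.1 with hG
  have hGm : ∀ j v, Measurable (G j v) := by
    intro j v
    have := hAm v j
    fun_prop
  have hmem : ∀ j v, MemLp (fun ω => G j v (W j ω)) (ENNReal.ofReal s) muI := by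
    intro j v
    refine MemLp.of_le ((Lp.memLp (A j v)).comp_measurePreserving (hU j))
      ((hGm j v).comp (hW j).measurable).aestronglyMeasurable (ae_of_all _ fun ω => ?_)
    rcases sgB_cases (W j ω).2 with h | h <;> simp [hG, h]
  let Z : ℕ → V →ₗ[ℝ] Lp ℝ (ENNReal.ofReal s) muI := fun j =>
    { toFun := fun v => (hmem j v).toLp _
      map_add' := by
        intro v w
        rw [← MemLp.toLp_add]
        apply MemLp.toLp_congr
        have h := (hU j).quasiMeasurePreserving.ae (p := fun u => A j (v + w) u = A j v u + A j w u)
          (by rw [map_add]; exact Lp.coeFn_add _ _)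
        filter_upwards [h] with ω hω
        simp only [hG, Pi.add_apply, hω]; ring
      map_smul' := by
        intro a v
        rw [RingHom.id_apply, ← MemLp.toLp_const_smul]
        apply MemLp.toLp_congr
        have h := (hU j).quasiMeasurePreserving.ae (p := fun u => A j (a • v) u = a * A j v u)
          (by rw [map_smul]; exact Lp.coeFn_smul _ _)
        filter_upwards [h] with ω hω
        simp only [hG, Pi.smul_apply, hω, smul_eq_mul]; ring }
  have hZ : ∀ j v, Z j v =ᵐ[muI] fun ω => G j v (W j ω) := fun j v => (hmem j v).coeFn_toLp
  have hev : ∀ (F : ℝ → ℝ), Measurable F → (∀ x, F (-x) = F x) → ∀ j v,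
      ∫⁻ ω, ENNReal.ofReal (F (Z j v ω)) ∂muI = ∫⁻ ω, ENNReal.ofReal (F (A j v ω)) ∂muI := by
    intro F hF hFe j v
    have hA := hAm v j
    rw [← (hU j).lintegral_comp (f := fun u => ENNReal.ofReal (F (A j v u))) (by fun_prop)]
    apply lintegral_congr_ae
    filter_upwards [hZ j v] with ω hω
    rw [hω]
    rcases sgB_cases (W j ω).2 with h | h <;> simp [hG, h, hFe]
  have hphi := hev (phiF s) (phiF_meas s) (phiF_neg s)
  have hcos := hev (fun x => 1 - Real.cos x) (by fun_prop) (by simp)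
  refine core hs hs2 Z ?_ ?_ K ?_ t η ht hη ?_ ?_
  · intro v
    refine iIndepFun.congr (fun j => (hZ j v).symm) ?_
    exact hWi.comp (fun j => G j v) (fun j => hGm j v)
  · intro v j
    have hfl : MeasurePreserving (Prod.map id (fun b : Bool => !b)) (muI.prod rhoB)
        (muI.prod rhoB) := (MeasurePreserving.id muI).prod rhoB_not
    have e1 : (fun ω => - Z j v ω) =ᵐ[muI] fun ω => - G j v (W j ω) := by
      filter_upwards [hZ j v] with ω hω
      rw [hω]
    rw [Measure.map_congr (hZ j v), Measure.map_congr e1]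
    have e2 : (fun ω => - G j v (W j ω)) =
        (G j v ∘ Prod.map id (fun b : Bool => !b)) ∘ W j := by
      ext ω; simp [hG, sgB_not]
    have e3 : (fun ω => G j v (W j ω)) = G j v ∘ W j := rfl
    rw [e2, e3, ← Measure.map_map ((hGm j v).comp hfl.measurable) (hW j).measurable,
      ← Measure.map_map (hGm j v) (hW j).measurable, (hW j).map_eq,
      ← Measure.map_map (hGm j v) hfl.measurable, hfl.map_eq]
  · intro v; simp_rw [hphi]; exact hup v
  · intro v hv j; rw [hcos]; exact hlo1 v hv j
  · intro v hv; simp_rw [hcos]; exact hlo2 v hv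

end iid

section hilbert

lemma exists_seq_basis (H : Type*) [NormedAddCommGroup H] [InnerProductSpace ℝ H] [CompleteSpace H]
    [TopologicalSpace.SeparableSpace H] :
    ∃ e : ℕ → H, ∀ v, HasSum (fun j => (inner ℝ (e j) v) ^ 2) (‖v‖ ^ 2) := by
  obtain ⟨w, b, hb⟩ := exists_hilbertBasis ℝ H
  have hcount : Countable w := by
    apply Pairwise.countable_of_isOpen_disjoint (s := fun i : w => Metric.ball (b i) (1 / 2))
    · intro i j hij
      apply Metric.ball_disjoint_ball
      have h1 : ‖b i - b j‖ ^ 2 = 2 := by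
        rw [norm_sub_sq_real, b.orthonormal.1 i, b.orthonormal.1 j, b.orthonormal.2 hij]; norm_num
      rw [dist_eq_norm]
      nlinarith [norm_nonneg (b i - b j)]
    · exact fun i => Metric.isOpen_ball
    · exact fun i => ⟨b i, Metric.mem_ball_self (by norm_num)⟩
  obtain ⟨enc, henc⟩ := hcount.exists_injective_nat
  refine ⟨Function.extend enc b 0, fun v => ?_⟩
  have h := b.hasSum_inner_mul_inner v v
  rw [real_inner_self_eq_norm_sq] at h
  have h2 : HasSum (fun i => (inner ℝ (b i) v) ^ 2) (‖v‖ ^ 2) := by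
    have : (fun i => (inner ℝ (b i) v) ^ 2) = fun i => inner ℝ v (b i) * inner ℝ (b i) v := by
      ext i
      rw [real_inner_comm, sq]
    rw [this]; exact h
  have h3 := (hasSum_extend_zero henc).2 h2
  refine h3.congr_fun ?_
  intro j
  by_cases hj : ∃ i, enc i = j
  · obtain ⟨i, rfl⟩ := hj
    rw [henc.extend_apply, henc.extend_apply]
  · rw [Function.extend_apply' _ _ _ hj, Function.extend_apply' _ _ _ hj]
    simp

theorem embed_two {s : ℝ} (hs : 1 ≤ s) (hs2 : s ≤ 2) [Fact (1 ≤ ENNReal.ofReal s)]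
    (q : ℝ≥0∞) [Fact (1 ≤ q)] (hq : q = 2) :
    ∃ T : Lp ℝ q muI → Lp ℝ (ENNReal.ofReal s) muI, ∃ c C : ℝ, 0 < c ∧ 0 < C ∧
      ∀ v w, c * ‖v - w‖ ≤ ‖T v - T w‖ ∧ ‖T v - T w‖ ≤ C * ‖v - w‖ := by
  subst hq
  haveI : Fact ((2:ℝ≥0∞) ≠ ∞) := ⟨by simp⟩
  obtain ⟨e, he⟩ := exists_seq_basis (Lp ℝ 2 muI)
  let A : ℕ → Lp ℝ 2 muI →ₗ[ℝ] Lp ℝ (ENNReal.ofReal s) muI := fun j =>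
    ((Lp.constL (ENNReal.ofReal s) muI ℝ : ℝ →L[ℝ] Lp ℝ (ENNReal.ofReal s) muI) ∘L
      (innerSL ℝ (e j))).toLinearMap
  have hA : ∀ j v, A j v =ᵐ[muI] fun _ => inner ℝ (e j) v := fun j v => Lp.coeFn_const _ _ _
  have hint : ∀ (F : ℝ → ℝ) j v, ∫⁻ ω, ENNReal.ofReal (F (A j v ω)) ∂muI =
      ENNReal.ofReal (F (inner ℝ (e j) v)) := by
    intro F j v
    have : ∫⁻ ω, ENNReal.ofReal (F (A j v ω)) ∂muI =
        ∫⁻ ω, ENNReal.ofReal (F (inner ℝ (e j) v)) ∂muI := by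
      apply lintegral_congr_ae
      filter_upwards [hA j v] with ω hω
      rw [hω]
    rw [this, lintegral_const, measure_univ, mul_one]
  have htsum : ∀ v, ∑' j, ENNReal.ofReal ((inner ℝ (e j) v) ^ 2) = ENNReal.ofReal (‖v‖ ^ 2) := by
    intro v
    rw [← (he v).tsum_eq, ENNReal.ofReal_tsum_of_nonneg (fun _ => sq_nonneg _) (he v).summable]
  have hle : ∀ v, ‖v‖ = 1 → ∀ j, (inner ℝ (e j) v) ^ 2 ≤ 1 := by
    intro v hv j
    have := le_hasSum (he v) j (fun _ _ => sq_nonneg _)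
    simpa [hv] using this
  refine core2 hs hs2 A (fun x => x ^ 2) ?_ 1 (2 / Real.pi ^ 2) one_pos (by positivity) ?_ ?_
  · intro v
    rw [← htsum]
    refine ENNReal.tsum_le_tsum fun j => ?_
    rw [hint]
    exact ENNReal.ofReal_le_ofReal (min_le_left _ _)
  · intro v hv j
    rw [hint (fun x => 1 - Real.cos x), ENNReal.ofReal_le_one]
    have := hle v hv j
    have := Real.one_sub_sq_div_two_le_cos (x := inner ℝ (e j) v)
    linarith
  · intro v hv
    have : ENNReal.ofReal (2 / Real.pi ^ 2) =
        ∑' j, ENNReal.ofReal (2 / Real.pi ^ 2) * ENNReal.ofReal ((inner ℝ (e j) v) ^ 2) := by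
      rw [ENNReal.tsum_mul_left, htsum, hv]; simp
    rw [this]
    refine ENNReal.tsum_le_tsum fun j => ?_
    rw [hint (fun x => 1 - Real.cos x), ← ENNReal.ofReal_mul (by positivity)]
    apply ENNReal.ofReal_le_ofReal
    have h1 := abs_le_one_iff_mul_self_le_one.2 (by simpa [sq] using hle v hv j)
    have h2 := Real.cos_le_one_sub_mul_cos_sq (x := inner ℝ (e j) v)
      (h1.trans (by linarith [Real.pi_gt_three]))
    linarith

end hilbert

section sums

lemma sum_phi {r s : ℝ} (hs : 1 ≤ s) (hsr : s < r) (hr2 : r < 2) :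
    ∃ C : ℝ, 0 ≤ C ∧ ∀ x : ℝ, ∑' j : ℕ, ENNReal.ofReal (phiF s (((j:ℝ) + 1) ^ (-(1 / r)) * x)) ≤
      ENNReal.ofReal (C * |x| ^ r) := by
  have hr0 : 0 < r := by linarith
  have hβ : -1 < -(s / r) := by
    have : s / r < 1 := (div_lt_one hr0).2 hsr
    linarith
  have hα : -(2 / r) < -1 := by
    have : 1 < 2 / r := (one_lt_div hr0).2 hr2
    linarith
  have hC1 : 0 < -(s / r) + 1 := by linarith
  have hC2 : 0 < 2 / r - 1 := by linarith
  refine ⟨1 / (-(s / r) + 1) + 1 / (2 / r - 1), by positivity, fun x => ?_⟩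
  rcases eq_or_ne x 0 with rfl | hx
  · simp [phiF]
  have hx0 : 0 < |x| := abs_pos.2 hx
  set τ : ℝ := |x| ^ r with hτ
  have hτ0 : 0 < τ := by positivity
  set h : ℝ → ℝ := fun y => min ((y / τ) ^ (-(2 / r))) ((y / τ) ^ (-(s / r))) with hh
  have hanti : ∀ y z, 0 < y → y ≤ z → h z ≤ h y := by
    intro y z hy hyz
    have h1 : 0 < y / τ := by positivity
    have h2 : y / τ ≤ z / τ := by gcongr
    exact min_le_min (Real.rpow_le_rpow_of_nonpos h1 h2 (by linarith))
      (Real.rpow_le_rpow_of_nonpos h1 h2 (by linarith [div_pos (by linarith : 0 < s) hr0]))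
  have heq : ∀ j : ℕ, phiF s (((j:ℝ) + 1) ^ (-(1 / r)) * x) = h (j + 1) := by
    intro j
    have hj : (0:ℝ) < j + 1 := by positivity
    have habs : |((j:ℝ) + 1) ^ (-(1 / r)) * x| = (((j:ℝ) + 1) / τ) ^ (-(1 / r)) := by
      rw [abs_mul, abs_of_pos (by positivity), Real.div_rpow hj.le hτ0.le, hτ,
        ← Real.rpow_mul hx0.le]
      have : r * -(1 / r) = -1 := by field_simp
      rw [this, Real.rpow_neg_one]; field_simp
    have hq : 0 < ((j:ℝ) + 1) / τ := by positivity
    unfold phiF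
    rw [← sq_abs, habs, ← Real.rpow_natCast, ← Real.rpow_mul hq.le, ← Real.rpow_mul hq.le]
    simp only [hh]
    congr 2
    · push_cast; ring
    · ring
  have hstep : ∀ j : ℕ, ENNReal.ofReal (h (j + 1)) ≤
      ∫⁻ y in Set.Ioc (j:ℝ) ((j + 1 : ℕ):ℝ), ENNReal.ofReal (h y) := by
    intro j
    calc ENNReal.ofReal (h (j + 1))
        = ∫⁻ y in Set.Ioc (j:ℝ) ((j + 1 : ℕ):ℝ), ENNReal.ofReal (h (j + 1)) := by simp
      _ ≤ _ := by
          apply setLIntegral_mono' measurableSet_Ioc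
          intro y hy
          apply ENNReal.ofReal_le_ofReal
          have := hy.2
          push_cast at this
          exact hanti _ _ (lt_of_le_of_lt (by positivity) hy.1) this
  have hdisj : Pairwise (Function.onFun Disjoint
      fun n : ℕ => Set.Ioc (n:ℝ) ((n + 1 : ℕ):ℝ)) :=
    (Nat.mono_cast (α := ℝ)).pairwise_disjoint_on_Ioc_succ
  calc ∑' j : ℕ, ENNReal.ofReal (phiF s (((j:ℝ) + 1) ^ (-(1 / r)) * x))
      ≤ ∑' j : ℕ, ∫⁻ y in Set.Ioc (j:ℝ) ((j + 1 : ℕ):ℝ), ENNReal.ofReal (h y) := by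
        refine ENNReal.tsum_le_tsum fun j => ?_
        rw [heq]; exact hstep j
    _ = ∫⁻ y in ⋃ j : ℕ, Set.Ioc (j:ℝ) ((j + 1 : ℕ):ℝ), ENNReal.ofReal (h y) :=
        (lintegral_iUnion (fun _ => measurableSet_Ioc) hdisj _).symm
    _ ≤ ∫⁻ y in Set.Ioc 0 τ ∪ Set.Ioi τ, ENNReal.ofReal (h y) := by
        apply lintegral_mono_set
        rw [Set.Ioc_union_Ioi_eq_Ioi hτ0.le]
        intro y hy
        obtain ⟨j, hj⟩ := Set.mem_iUnion.1 hy
        exact lt_of_le_of_lt (by positivity) hj.1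
    _ ≤ (∫⁻ y in Set.Ioc 0 τ, ENNReal.ofReal (h y)) + ∫⁻ y in Set.Ioi τ, ENNReal.ofReal (h y) :=
        lintegral_union_le _ _ _
    _ ≤ ENNReal.ofReal (1 / (-(s / r) + 1) * τ) + ENNReal.ofReal (1 / (2 / r - 1) * τ) := by
        gcongr
        · have hi : IntegrableOn (fun y : ℝ => y ^ (-(s / r))) (Set.Ioc 0 τ) :=
            (intervalIntegrable_iff_integrableOn_Ioc_of_le hτ0.le).1
              (intervalIntegral.intervalIntegrable_rpow' hβ)
          have hi2 : IntegrableOn (fun y : ℝ => y ^ (-(s / r)) * τ ^ (s / r)) (Set.Ioc 0 τ) :=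
            hi.mul_const _
          calc _ ≤ ∫⁻ y in Set.Ioc 0 τ, ENNReal.ofReal (y ^ (-(s / r)) * τ ^ (s / r)) := by
                apply setLIntegral_mono' measurableSet_Ioc
                intro y hy
                apply ENNReal.ofReal_le_ofReal
                refine (min_le_right _ _).trans (le_of_eq ?_)
                rw [Real.div_rpow hy.1.le hτ0.le, Real.rpow_neg hτ0.le]; field_simp
            _ = ENNReal.ofReal (∫ y in Set.Ioc 0 τ, y ^ (-(s / r)) * τ ^ (s / r)) := by
                rw [ofReal_integral_eq_lintegral_ofReal hi2]
                filter_upwards [ae_restrict_mem measurableSet_Ioc] with y hy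
                have := hy.1
                positivity
            _ = _ := by
                congr 1
                rw [integral_mul_const, ← intervalIntegral.integral_of_le hτ0.le,
                  integral_rpow (Or.inl hβ), Real.zero_rpow hC1.ne', sub_zero, div_mul_eq_mul_div,
                  ← Real.rpow_add hτ0]
                rw [show -(s / r) + 1 + s / r = 1 by ring, Real.rpow_one]; ring
        · have hi : IntegrableOn (fun y : ℝ => y ^ (-(2 / r))) (Set.Ioi τ) :=
            integrableOn_Ioi_rpow_of_lt hα hτ0
          have hi2 : IntegrableOn (fun y : ℝ => y ^ (-(2 / r)) * τ ^ (2 / r)) (Set.Ioi τ) :=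
            hi.mul_const _
          calc _ ≤ ∫⁻ y in Set.Ioi τ, ENNReal.ofReal (y ^ (-(2 / r)) * τ ^ (2 / r)) := by
                apply setLIntegral_mono' measurableSet_Ioi
                intro y hy
                apply ENNReal.ofReal_le_ofReal
                refine (min_le_left _ _).trans (le_of_eq ?_)
                rw [Real.div_rpow (hτ0.trans hy).le hτ0.le, Real.rpow_neg hτ0.le]; field_simp
            _ = ENNReal.ofReal (∫ y in Set.Ioi τ, y ^ (-(2 / r)) * τ ^ (2 / r)) := by
                rw [ofReal_integral_eq_lintegral_ofReal hi2]
                filter_upwards [ae_restrict_mem measurableSet_Ioi] with y hy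
                have := hτ0.trans hy
                positivity
            _ = _ := by
                congr 1
                rw [integral_mul_const, integral_Ioi_rpow_of_lt hα hτ0, div_mul_eq_mul_div,
                  neg_mul, ← Real.rpow_add hτ0]
                rw [show -(2 / r) + 1 + 2 / r = 1 by ring, Real.rpow_one]
                have : -(2 / r) + 1 = -(2 / r - 1) := by ring
                rw [this, neg_div_neg_eq]; ring
    _ = _ := by
        rw [← ENNReal.ofReal_add (by positivity) (by positivity), add_mul]

lemma sum_cos {r : ℝ} (hr : 1 ≤ r) :
    ∃ κ : ℝ, 0 < κ ∧ ∀ x : ℝ, ENNReal.ofReal (4 * κ * |x| ^ r) ≤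
      ∑' j : ℕ, ENNReal.ofReal (1 - Real.cos (((j:ℝ) + 1) ^ (-(1 / r)) * x)) +
        ENNReal.ofReal κ := by
  have hr0 : 0 < r := by linarith
  refine ⟨2 / Real.pi ^ 2 * (1 / 5) ^ 2, by positivity, fun x => ?_⟩
  set κ : ℝ := 2 / Real.pi ^ 2 * (1 / 5) ^ 2 with hκ
  have hκ0 : 0 < κ := by positivity
  rcases eq_or_ne x 0 with rfl | hx
  · simp [Real.zero_rpow hr0.ne']
  have hx0 : 0 < |x| := abs_pos.2 hx
  set τ : ℝ := |x| ^ r with hτ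
  have hτ0 : 0 < τ := by positivity
  set F : Finset ℕ := Finset.Ico (⌈τ⌉₊ - 1) ⌊5 * τ⌋₊ with hF
  have hceil : 1 ≤ ⌈τ⌉₊ := Nat.one_le_ceil_iff.2 hτ0
  have hcard : 4 * τ - 1 ≤ (F.card : ℝ) := by
    have h1 : ⌊5 * τ⌋₊ ≤ F.card + (⌈τ⌉₊ - 1) := by
      rw [hF, Nat.card_Ico]; omega
    have h2 : ⌊5 * τ⌋₊ + 1 ≤ F.card + ⌈τ⌉₊ := by omega
    have h3 : ((⌊5 * τ⌋₊ : ℝ)) + 1 ≤ F.card + ⌈τ⌉₊ := by exact_mod_cast h2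
    have h4 := Nat.lt_floor_add_one (5 * τ)
    have h5 := Nat.ceil_lt_add_one hτ0.le
    linarith
  have hterm : ∀ j ∈ F, κ ≤ 1 - Real.cos (((j:ℝ) + 1) ^ (-(1 / r)) * x) := by
    intro j hj
    rw [hF, Finset.mem_Ico] at hj
    have hj1 : τ ≤ (j:ℝ) + 1 := by
      have : ⌈τ⌉₊ ≤ j + 1 := by omega
      exact_mod_cast Nat.ceil_le.1 this
    have hj2 : (j:ℝ) + 1 ≤ 5 * τ := by
      have : j + 1 ≤ ⌊5 * τ⌋₊ := hj.2
      exact_mod_cast (Nat.le_floor_iff (by positivity)).1 this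
    have hjp : (0:ℝ) < j + 1 := by positivity
    have habs : |((j:ℝ) + 1) ^ (-(1 / r)) * x| = (τ / ((j:ℝ) + 1)) ^ (1 / r) := by
      rw [abs_mul, abs_of_pos (by positivity), Real.div_rpow hτ0.le hjp.le, hτ,
        ← Real.rpow_mul hx0.le, Real.rpow_neg hjp.le]
      have : r * (1 / r) = 1 := by field_simp
      rw [this, Real.rpow_one]; field_simp
    have hu1 : τ / ((j:ℝ) + 1) ≤ 1 := (div_le_one hjp).2 hj1
    have hu2 : 1 / 5 ≤ τ / ((j:ℝ) + 1) := by rw [div_le_div_iff₀ (by norm_num) hjp]; linarith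
    have hup : 0 < τ / ((j:ℝ) + 1) := by positivity
    have h1 : |((j:ℝ) + 1) ^ (-(1 / r)) * x| ≤ 1 := by
      rw [habs]; exact Real.rpow_le_one hup.le hu1 (by positivity)
    have h2 : 1 / 5 ≤ |((j:ℝ) + 1) ^ (-(1 / r)) * x| := by
      rw [habs]
      refine hu2.trans ?_
      calc τ / ((j:ℝ) + 1) = (τ / ((j:ℝ) + 1)) ^ (1:ℝ) := (Real.rpow_one _).symm
        _ ≤ _ := Real.rpow_le_rpow_of_exponent_ge hup hu1 ((div_le_one hr0).2 hr)
    have h3 := Real.cos_le_one_sub_mul_cos_sq (x := ((j:ℝ) + 1) ^ (-(1 / r)) * x)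
      (h1.trans (by linarith [Real.pi_gt_three]))
    have h4 : κ ≤ 2 / Real.pi ^ 2 * (((j:ℝ) + 1) ^ (-(1 / r)) * x) ^ 2 := by
      rw [hκ, ← sq_abs (((j:ℝ) + 1) ^ (-(1 / r)) * x)]
      gcongr
    linarith
  calc ENNReal.ofReal (4 * κ * τ) ≤ ENNReal.ofReal (F.card * κ + κ) := by
        apply ENNReal.ofReal_le_ofReal; nlinarith
    _ = ∑ j ∈ F, ENNReal.ofReal κ + ENNReal.ofReal κ := by
        rw [ENNReal.ofReal_add (by positivity) hκ0.le, Finset.sum_const, nsmul_eq_mul,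
          ENNReal.ofReal_mul (by positivity), ENNReal.ofReal_natCast]
    _ ≤ ∑ j ∈ F, ENNReal.ofReal (1 - Real.cos (((j:ℝ) + 1) ^ (-(1 / r)) * x)) +
        ENNReal.ofReal κ := by
        gcongr with j hj
        exact hterm j hj
    _ ≤ _ := by
        gcongr
        exact ENNReal.sum_le_tsum F

end sums

section final

theorem embed_lt {r s : ℝ} (hs : 1 ≤ s) (hsr : s < r) (hr2 : r < 2)
    [Fact (1 ≤ ENNReal.ofReal s)] [Fact (1 ≤ ENNReal.ofReal r)] :
    ∃ T : Lp ℝ (ENNReal.ofReal r) muI → Lp ℝ (ENNReal.ofReal s) muI, ∃ c C : ℝ,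
      0 < c ∧ 0 < C ∧
      ∀ v w, c * ‖v - w‖ ≤ ‖T v - T w‖ ∧ ‖T v - T w‖ ≤ C * ‖v - w‖ := by
  have hr : 1 ≤ r := hs.trans hsr.le
  have hr0 : 0 < r := by linarith
  obtain ⟨C, hC, hphi⟩ := sum_phi hs hsr hr2
  obtain ⟨κ, hκ, hcos⟩ := sum_cos hr
  have hmem : ∀ v : Lp ℝ (ENNReal.ofReal r) muI, MemLp v (ENNReal.ofReal s) muI := fun v =>
    (Lp.memLp v).mono_exponent (ENNReal.ofReal_le_ofReal hsr.le)
  let J : Lp ℝ (ENNReal.ofReal r) muI →ₗ[ℝ] Lp ℝ (ENNReal.ofReal s) muI :=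
    { toFun := fun v => (hmem v).toLp _
      map_add' := by
        intro v w
        rw [← MemLp.toLp_add]
        exact MemLp.toLp_congr _ _ (Lp.coeFn_add _ _)
      map_smul' := by
        intro a v
        rw [RingHom.id_apply, ← MemLp.toLp_const_smul]
        exact MemLp.toLp_congr _ _ (Lp.coeFn_smul _ _) }
  have hJ : ∀ v, J v =ᵐ[muI] v := fun v => (hmem v).coeFn_toLp
  let A : ℕ → Lp ℝ (ENNReal.ofReal r) muI →ₗ[ℝ] Lp ℝ (ENNReal.ofReal s) muI := fun j =>
    (((j : ℝ) + 1) ^ (-(1 / r))) • J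
  have hA : ∀ j v, A j v =ᵐ[muI] fun u => ((j : ℝ) + 1) ^ (-(1 / r)) * v u := by
    intro j v
    have h1 : A j v = (((j : ℝ) + 1) ^ (-(1 / r))) • J v := rfl
    rw [h1]
    filter_upwards [Lp.coeFn_smul (((j : ℝ) + 1) ^ (-(1 / r))) (J v), hJ v] with u h2 h3
    rw [h2, Pi.smul_apply, h3, smul_eq_mul]
  have hint : ∀ (F : ℝ → ℝ) j v, ∫⁻ ω, ENNReal.ofReal (F (A j v ω)) ∂muI =
      ∫⁻ ω, ENNReal.ofReal (F (((j : ℝ) + 1) ^ (-(1 / r)) * v ω)) ∂muI := by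
    intro F j v
    apply lintegral_congr_ae
    filter_upwards [hA j v] with ω hω
    rw [hω]
  have hvm : ∀ v : Lp ℝ (ENNReal.ofReal r) muI, Measurable v := fun v =>
    (Lp.stronglyMeasurable v).measurable
  have hsum : ∀ (F : ℝ → ℝ), Measurable F → ∀ v,
      ∑' j, ∫⁻ ω, ENNReal.ofReal (F (A j v ω)) ∂muI =
      ∫⁻ ω, ∑' j : ℕ, ENNReal.ofReal (F (((j : ℝ) + 1) ^ (-(1 / r)) * v ω)) ∂muI := by
    intro F hF v
    simp_rw [hint]
    rw [lintegral_tsum]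
    intro j
    have := hvm v
    exact Measurable.aemeasurable (by fun_prop)
  have htr : ((1 / 2 : ℝ) ^ (1 / r)) ^ r = 1 / 2 := by
    rw [← Real.rpow_mul (by norm_num), one_div_mul_cancel hr0.ne', Real.rpow_one]
  refine core2 hs (hsr.trans hr2).le A (fun x => C * x ^ r) ?_ ((1 / 2) ^ (1 / r)) κ
    (by positivity) hκ ?_ ?_
  · intro v
    rw [hsum _ (phiF_meas s)]
    calc _ ≤ ∫⁻ ω, ENNReal.ofReal C * ENNReal.ofReal (|v ω| ^ r) ∂muI := by
          apply lintegral_mono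
          intro ω
          beta_reduce
          rw [← ENNReal.ofReal_mul hC]
          exact hphi _
      _ = _ := by
          rw [lintegral_const_mul' _ _ ENNReal.ofReal_ne_top, ← lp_norm_pow hr, ENNReal.ofReal_mul hC]
  · intro v hv j
    rw [hint (fun x => 1 - Real.cos x)]
    calc _ ≤ ∫⁻ ω, ENNReal.ofReal 2 * ENNReal.ofReal (|v ω| ^ r) ∂muI := by
          apply lintegral_mono
          intro ω
          beta_reduce
          rw [← ENNReal.ofReal_mul (by norm_num)]
          apply ENNReal.ofReal_le_ofReal
          refine (one_sub_cos_le hr hr2.le _).trans ?_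
          have hj : (1 : ℝ) ≤ (j : ℝ) + 1 := by
            have : (0 : ℝ) ≤ j := Nat.cast_nonneg j
            linarith
          have h1 : ((j : ℝ) + 1) ^ (-(1 / r)) ≤ 1 :=
            Real.rpow_le_one_of_one_le_of_nonpos hj (by
              have : 0 < 1 / r := by positivity
              linarith)
          have h2 : 0 ≤ ((j : ℝ) + 1) ^ (-(1 / r)) := by positivity
          have h3 : |((j : ℝ) + 1) ^ (-(1 / r)) * v ω| ≤ |v ω| := by
            rw [abs_mul, abs_of_nonneg h2]
            exact mul_le_of_le_one_left (abs_nonneg _) h1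
          have := Real.rpow_le_rpow (abs_nonneg _) h3 hr0.le
          linarith
      _ ≤ 1 := by
          rw [lintegral_const_mul' _ _ ENNReal.ofReal_ne_top, ← lp_norm_pow hr, hv, htr,
            ← ENNReal.ofReal_mul (by norm_num)]
          norm_num
  · intro v hv
    rw [hsum (fun x => 1 - Real.cos x) (by fun_prop)]
    have h1 : ∫⁻ ω, ENNReal.ofReal (4 * κ) * ENNReal.ofReal (|v ω| ^ r) ∂muI ≤
        ∫⁻ ω, (∑' j : ℕ, ENNReal.ofReal (1 - Real.cos (((j : ℝ) + 1) ^ (-(1 / r)) * v ω))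
          + ENNReal.ofReal κ) ∂muI := by
      apply lintegral_mono
      intro ω
      beta_reduce
      rw [← ENNReal.ofReal_mul (by positivity)]
      exact hcos _
    rw [lintegral_const_mul' _ _ ENNReal.ofReal_ne_top, ← lp_norm_pow hr, hv, htr,
      lintegral_add_right _ measurable_const, lintegral_const, measure_univ, mul_one,
      ← ENNReal.ofReal_mul (by positivity)] at h1
    have h2 : 4 * κ * (1 / 2) = κ + κ := by ring
    rw [h2, ENNReal.ofReal_add hκ.le hκ.le] at h1
    exact (ENNReal.add_le_add_iff_right ENNReal.ofReal_ne_top).1 h1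

lemma reduce_of_embed {X Y : Type*} [NormedAddCommGroup X] [NormedAddCommGroup Y]
    [MeasurableSpace X] [BorelSpace X] [MeasurableSpace Y] [BorelSpace Y] {p : ℝ} (hp : 1 ≤ p)
    (h : ∃ T : X → Y, ∃ c C : ℝ, 0 < c ∧ 0 < C ∧
      ∀ v w, c * ‖v - w‖ ≤ ‖T v - T w‖ ∧ ‖T v - T w‖ ≤ C * ‖v - w‖) :
    BorelReducible (ESum X p) (ESum Y p) := by
  obtain ⟨T, c, C, hc, hC, hT⟩ := h
  have hp0 : 0 ≤ p := by linarith
  have hTc : Continuous T := by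
    apply LipschitzWith.continuous (K := C.toNNReal)
    apply LipschitzWith.of_dist_le_mul
    intro v w
    rw [dist_eq_norm, dist_eq_norm, Real.coe_toNNReal _ hC.le]
    exact (hT v w).2
  refine ⟨fun x n => T (x n), ?_, fun x y => ?_⟩
  · exact measurable_pi_lambda _ fun n => hTc.measurable.comp (measurable_pi_apply n)
  · unfold ESum
    constructor
    · intro h
      refine Summable.of_nonneg_of_le (fun n => by positivity) (fun n => ?_)
        (h.mul_left (C ^ p))
      rw [← Real.mul_rpow hC.le (norm_nonneg _)]
      exact Real.rpow_le_rpow (norm_nonneg _) (hT _ _).2 hp0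
    · intro h
      have hcp : 0 < c ^ p := by positivity
      rw [← summable_mul_left_iff hcp.ne']
      refine Summable.of_nonneg_of_le (fun n => by positivity) (fun n => ?_) h
      rw [← Real.mul_rpow hc.le (norm_nonneg _)]
      exact Real.rpow_le_rpow (by positivity) (hT _ _).1 hp0

end final

end mine

theorem ELr_reducible_ELs (p r s : ℝ) (hp : 1 ≤ p) (hr : 1 ≤ r) (hr2 : r ≤ 2)
    (hs : 1 ≤ s) (hs2 : s ≤ 2) (hsr : s ≤ r)
    [Fact (1 ≤ ENNReal.ofReal r)] [Fact (1 ≤ ENNReal.ofReal s)] :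
    BorelReducible (ESum (LSp r) p) (ESum (LSp s) p) := by
  apply reduce_of_embed hp
  rcases hsr.eq_or_lt with h | h
  · subst h
    exact ⟨id, 1, 1, one_pos, one_pos, fun v w => by simp⟩
  · rcases hr2.eq_or_lt with h2 | h2
    · exact embed_two hs hs2 (ENNReal.ofReal r) (by rw [h2]; simp)
    · exact embed_lt hs h h2
end
end

section
/- Let r,s,p,q ∈ [1,+∞) with r/p = s/q and p ≤ q. Then E(ℓ_r,p) is Borel reducible to E(ℓ_s,q), and E(L_r,p) is Borel reducible to E(L_s,q). -/
open Filter Topology MeasureTheory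
open scoped ENNReal NNReal

noncomputable section

section weier

/-- Terms of the Weierstrass-type series. -/
def wTerm (B u : ℝ) (m : ℤ) (x : ℝ) : ℂ :=
  ((u ^ m : ℝ) : ℂ) * (Complex.exp (Complex.I * ((B ^ m * x : ℝ) : ℂ)) - 1)

/-- Majorant. -/
def wBd (u v : ℝ) (m : ℤ) : ℝ := if 0 ≤ m then 2 * u ^ m else v ^ (-m)

/-- Weierstrass-type function. -/
def wFun (B u : ℝ) (x : ℝ) : ℂ := ∑' m : ℤ, wTerm B u m x

lemma wTerm_sub_norm (B u : ℝ) (hu : 0 < u) (m : ℤ) (x y : ℝ) :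
    ‖wTerm B u m x - wTerm B u m y‖ =
      u ^ m * ‖Complex.exp (Complex.I * ((B ^ m * (x - y) : ℝ) : ℂ)) - 1‖ := by
  have h : wTerm B u m x - wTerm B u m y = ((u ^ m : ℝ) : ℂ) *
      (Complex.exp (Complex.I * ((B ^ m * y : ℝ) : ℂ)) *
      (Complex.exp (Complex.I * ((B ^ m * (x - y) : ℝ) : ℂ)) - 1)) := by
    unfold wTerm
    rw [mul_sub (Complex.exp _), ← Complex.exp_add]
    have : Complex.I * ((B ^ m * y : ℝ) : ℂ) + Complex.I * ((B ^ m * (x - y) : ℝ) : ℂ)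
      = Complex.I * ((B ^ m * x : ℝ) : ℂ) := by push_cast; ring
    rw [this]; ring
  rw [h, norm_mul, norm_mul, Complex.norm_exp_I_mul_ofReal, one_mul, Complex.norm_real,
    Real.norm_of_nonneg (zpow_pos hu m).le]

lemma wTerm_sub_le (B u v : ℝ) (hB : 0 < B) (hu : 0 < u) (hv : 0 < v) (h : u * B * v = 1)
    (m : ℤ) (x y : ℝ) :
    ‖wTerm B u m x - wTerm B u m y‖ ≤ max 1 |x - y| * wBd u v m := by
  rw [wTerm_sub_norm B u hu]
  have hum := zpow_pos hu m
  unfold wBd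
  split_ifs with hm
  · have h2 : ‖Complex.exp (Complex.I * ((B ^ m * (x - y) : ℝ) : ℂ)) - 1‖ ≤ 2 := by
      refine (norm_sub_le _ _).trans ?_
      rw [Complex.norm_exp_I_mul_ofReal]; norm_num
    calc _ ≤ u ^ m * 2 := by gcongr
      _ = 1 * (2 * u ^ m) := by ring
      _ ≤ _ := by gcongr; exact le_max_left _ _
  · have h2 := Real.norm_exp_I_mul_ofReal_sub_one_le (x := B ^ m * (x - y))
    have h3 : u ^ m * B ^ m = v ^ (-m) := by
      rw [← mul_zpow, eq_inv_of_mul_eq_one_left h, zpow_neg, inv_zpow]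
    calc _ ≤ u ^ m * ‖B ^ m * (x - y)‖ := by gcongr
      _ = |x - y| * v ^ (-m) := by
        rw [← h3, norm_mul, Real.norm_of_nonneg (zpow_pos hB m).le, Real.norm_eq_abs]; ring
      _ ≤ _ := by gcongr; exact le_max_right _ _

lemma wBd_hasSum (u v : ℝ) (hu : 0 < u) (hv : 0 < v) (hu1 : u < 1) (hv1 : v < 1) :
    HasSum (wBd u v) (2 / (1 - u) + v / (1 - v)) := by
  apply HasSum.of_nat_of_neg_add_one
  · have := (hasSum_geometric_of_lt_one hu.le hu1).mul_left 2
    simpa [wBd, div_eq_mul_inv] using this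
  · have := (hasSum_geometric_of_lt_one hv.le hv1).mul_left v
    rw [← div_eq_mul_inv] at this
    have e : (fun n : ℕ => wBd u v (-((n : ℤ) + 1))) = fun n => v * v ^ n := by
      ext n
      unfold wBd
      rw [if_neg (by omega), neg_neg, ← pow_succ']
      exact_mod_cast rfl
    rw [e]; exact this

lemma wTerm_zero (B u : ℝ) (m : ℤ) : wTerm B u m 0 = 0 := by simp [wTerm]

lemma wTerm_summable (B u v : ℝ) (hB : 0 < B) (hu : 0 < u) (hv : 0 < v) (h : u * B * v = 1)
    (hu1 : u < 1) (hv1 : v < 1) (x : ℝ) : Summable (fun m => wTerm B u m x) := by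
  refine Summable.of_norm_bounded
    ((wBd_hasSum u v hu hv hu1 hv1).summable.mul_left (max 1 |x - 0|)) fun m => ?_
  have := wTerm_sub_le B u v hB hu hv h m x 0
  rwa [wTerm_zero, sub_zero] at this

lemma wFun_scale (B u : ℝ) (hB : 0 < B) (hu : 0 < u) (k : ℤ) (x : ℝ) :
    wFun B u x = ((u ^ k : ℝ) : ℂ) * wFun B u (B ^ k * x) := by
  unfold wFun
  rw [← tsum_mul_left, ← (Equiv.addRight k).tsum_eq]
  congr 1; ext m
  simp only [Equiv.coe_addRight, wTerm]
  rw [zpow_add₀ hu.ne', zpow_add₀ hB.ne', mul_assoc (B ^ m)]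
  push_cast; ring

lemma wFun_upper (B u v : ℝ) (hB : 0 < B) (hu : 0 < u) (hv : 0 < v) (h : u * B * v = 1)
    (hu1 : u ≤ 1 / 32) (hv1 : v ≤ 1 / 32) (x y : ℝ) (hxy : |x - y| ≤ 1) :
    ‖wFun B u x - wFun B u y‖ ≤ 3 := by
  have hs := wTerm_summable B u v hB hu hv h (by linarith) (by linarith)
  unfold wFun
  rw [← (hs x).tsum_sub (hs y)]
  refine (tsum_of_norm_bounded (wBd_hasSum u v hu hv (by linarith) (by linarith))
    fun m => ?_).trans ?_
  · have := wTerm_sub_le B u v hB hu hv h m x y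
    rwa [max_eq_left hxy, one_mul] at this
  · have h1 : 2 / (1 - u) ≤ 2 / (1 - 1/32) := by gcongr
    have h2 : v / (1 - v) ≤ (1/32) / (1 - 1/32) := by gcongr
    norm_num at h1 h2; linarith

lemma wFun_lower (B u v : ℝ) (hB : 0 < B) (hu : 0 < u) (hv : 0 < v) (h : u * B * v = 1)
    (hu1 : u ≤ 1 / 32) (hv1 : v ≤ 1 / 32) (x y : ℝ) (hxy : |x - y| ≤ 1)
    (hxy2 : 1 / 2 ≤ |x - y|) :
    1 / 10 ≤ ‖wFun B u x - wFun B u y‖ := by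
  have hs := wTerm_summable B u v hB hu hv h (by linarith) (by linarith)
  have hsum := (hs x).hasSum.sub (hs y).hasSum
  have hb := wBd_hasSum u v hu hv (by linarith) (by linarith)
  have hd' := hsum.update 0 0
  have hb' := hb.update 0 0
  have key : ‖0 - (wTerm B u 0 x - wTerm B u 0 y) + (wFun B u x - wFun B u y)‖
      ≤ 0 - wBd u v 0 + (2 / (1 - u) + v / (1 - v)) := by
    have := tsum_of_norm_bounded hb' (f := Function.update
      (fun m => wTerm B u m x - wTerm B u m y) 0 0) fun m => ?_
    · rwa [hd'.tsum_eq] at this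
    · by_cases hm : m = 0
      · subst hm; simp
      · rw [Function.update_of_ne hm, Function.update_of_ne hm]
        have := wTerm_sub_le B u v hB hu hv h m x y
        rwa [max_eq_left hxy, one_mul] at this
  have h0 : wBd u v 0 = 2 := by simp [wBd]
  have h1 : 2 / (1 - u) ≤ 2 / (1 - 1/32) := by gcongr
  have h2 : v / (1 - v) ≤ (1/32) / (1 - 1/32) := by gcongr
  have hmain : 3 / 10 ≤ ‖wTerm B u 0 x - wTerm B u 0 y‖ := by
    rw [wTerm_sub_norm B u hu, zpow_zero, one_mul, Complex.norm_exp_I_mul_ofReal_sub_one]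
    rw [zpow_zero, one_mul, norm_mul, Real.norm_eq_abs (Real.sin _)]
    have hpi := Real.pi_lt_d2
    have hpi0 := Real.pi_pos
    have hpi3 := Real.pi_gt_three
    have ha : |(x - y) / 2| = |x - y| / 2 := by rw [abs_div]; norm_num
    have := Real.mul_abs_le_abs_sin (x := (x - y) / 2) (by rw [ha]; linarith)
    rw [ha] at this
    have h5 : 3 / 5 ≤ 2 / Real.pi := by rw [div_le_div_iff₀ (by norm_num) hpi0]; linarith
    have : 3 / 5 * (1 / 2 / 2) ≤ |Real.sin ((x - y) / 2)| := le_trans (by gcongr) this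
    norm_num at this ⊢; linarith
  have htri : ‖wTerm B u 0 x - wTerm B u 0 y‖ ≤ ‖wFun B u x - wFun B u y‖ +
      ‖0 - (wTerm B u 0 x - wTerm B u 0 y) + (wFun B u x - wFun B u y)‖ := by
    have := norm_sub_le (wFun B u x - wFun B u y)
      (0 - (wTerm B u 0 x - wTerm B u 0 y) + (wFun B u x - wFun B u y))
    have e : wFun B u x - wFun B u y -
      (0 - (wTerm B u 0 x - wTerm B u 0 y) + (wFun B u x - wFun B u y))
      = wTerm B u 0 x - wTerm B u 0 y := by ring
    rwa [e] at this
  norm_num at h1 h2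
  linarith

lemma snow_complex (α : ℝ) (h0 : 0 < α) (h1 : α < 1) :
    ∃ (M : ℕ) (F : ℝ → ℂ) (C c : ℝ), 0 < M ∧ 0 ≤ C ∧ 0 < c ∧
      (∀ x y, ‖F x - F y‖ ≤ C * |x - y| ^ α) ∧
      (∀ x y (k : ℤ), |x - y| * ((2:ℝ) ^ M) ^ k ≤ 1 → 1 / 2 ≤ |x - y| * ((2:ℝ) ^ M) ^ k →
        c * |x - y| ^ α ≤ ‖F x - F y‖) := by
  obtain ⟨M, hM⟩ : ∃ M : ℕ, 5 / α + 5 / (1 - α) < M := exists_nat_gt _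
  have h1' : 0 < 1 - α := by linarith
  have ha : 0 < 5 / α := by positivity
  have hb : 0 < 5 / (1 - α) := by positivity
  have hM0 : (0:ℝ) < M := by linarith
  have hMa : 5 ≤ M * α := by
    have : 5 / α ≤ M := by linarith
    rwa [div_le_iff₀ h0] at this
  have hMb : 5 ≤ M * (1 - α) := by
    have : 5 / (1 - α) ≤ M := by linarith
    rwa [div_le_iff₀ h1'] at this
  set B : ℝ := 2 ^ M with hBdef
  have hB2 : B = (2:ℝ) ^ (M : ℝ) := by rw [hBdef, Real.rpow_natCast]
  have hB : 0 < B := by positivity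
  have hB1 : 1 < B := one_lt_pow₀ (by norm_num) (by rintro rfl; simp at hM0)
  have h32 : (1:ℝ) / 32 = 2 ^ (-5 : ℝ) := by
    rw [Real.rpow_neg (by norm_num)]; norm_num
  set u : ℝ := B ^ (-α) with hu
  set v : ℝ := B ^ (α - 1) with hv
  have hu0 : 0 < u := by positivity
  have hv0 : 0 < v := by positivity
  have hu1 : u ≤ 1 / 32 := by
    rw [h32, hu, hB2, ← Real.rpow_mul (by norm_num)]
    exact Real.rpow_le_rpow_of_exponent_le (by norm_num) (by linarith)
  have hv1 : v ≤ 1 / 32 := by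
    rw [h32, hv, hB2, ← Real.rpow_mul (by norm_num)]
    exact Real.rpow_le_rpow_of_exponent_le (by norm_num) (by linarith)
  have huv : u * B * v = 1 := by
    rw [hu, hv]
    nth_rewrite 2 [← Real.rpow_one B]
    rw [← Real.rpow_add hB, ← Real.rpow_add hB]
    ring_nf; simp
  have huk : ∀ k : ℤ, u ^ k = ((B ^ (-k)) ^ α : ℝ) := by
    intro k
    rw [hu, ← Real.rpow_intCast, ← Real.rpow_intCast, ← Real.rpow_mul hB.le,
      ← Real.rpow_mul hB.le]
    push_cast; ring_nf
  have hsc : ∀ (k : ℤ) x y, ‖wFun B u x - wFun B u y‖ =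
      (B ^ (-k)) ^ α * ‖wFun B u (B ^ k * x) - wFun B u (B ^ k * y)‖ := by
    intro k x y
    rw [wFun_scale B u hB hu0 k x, wFun_scale B u hB hu0 k y, ← mul_sub, norm_mul,
      Complex.norm_real, Real.norm_of_nonneg (zpow_pos hu0 k).le, huk]
  have habs : ∀ (k : ℤ) (x y : ℝ), |B ^ k * x - B ^ k * y| = |x - y| * B ^ k := by
    intro k x y
    rw [← mul_sub, abs_mul, abs_of_pos (zpow_pos hB k), mul_comm]
  refine ⟨M, wFun B u, B ^ α * 3, 1 / 10, by exact_mod_cast hM0, by positivity, by norm_num,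
    ?_, ?_⟩
  · intro x y
    rcases eq_or_ne x y with rfl | hne
    · simp only [sub_self, norm_zero]; positivity
    have hd : 0 < |x - y| := abs_pos.2 (sub_ne_zero.2 hne)
    obtain ⟨n, hn1, hn2⟩ := exists_mem_Ioc_zpow hd hB1
    rw [hsc (-(n+1)) x y, neg_neg]
    have := wFun_upper B u v hB hu0 hv0 huv hu1 hv1 (B ^ (-(n+1)) * x) (B ^ (-(n+1)) * y) (by
      rw [habs, zpow_neg, ← div_eq_mul_inv]
      exact div_le_one_of_le₀ hn2 (zpow_pos hB _).le)
    calc _ ≤ (B ^ (n+1)) ^ α * 3 := by gcongr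
      _ = B ^ α * 3 * (B ^ n) ^ α := by
        rw [zpow_add_one₀ hB.ne', Real.mul_rpow (zpow_pos hB _).le hB.le]; ring
      _ ≤ _ := by gcongr
  · intro x y k hk1 hk2
    rw [hsc k x y]
    have := wFun_lower B u v hB hu0 hv0 huv hu1 hv1 (B ^ k * x) (B ^ k * y)
      (by rwa [habs]) (by rwa [habs])
    have h3 : |x - y| ≤ B ^ (-k) := by
      rw [zpow_neg, ← one_div, le_div_iff₀ (zpow_pos hB _)]; exact hk1
    rw [mul_comm]
    gcongr

lemma snow (α : ℝ) (h0 : 0 < α) (h1 : α ≤ 1) :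
    ∃ (ι : Type) (_ : Fintype ι) (_ : Nonempty ι) (φ : ι → ℝ → ℝ) (C c : ℝ), 0 ≤ C ∧ 0 < c ∧
      (∀ i, φ i 0 = 0) ∧
      (∀ i x y, |φ i x - φ i y| ≤ C * |x - y| ^ α) ∧
      (∀ x y, c * |x - y| ^ α ≤ ∑ i, |φ i x - φ i y|) := by
  rcases h1.eq_or_lt with rfl | h1
  · refine ⟨Unit, inferInstance, inferInstance, fun _ x => x, 1, 1, by norm_num, by norm_num,
      by simp, by simp, by simp⟩
  obtain ⟨M, F, C, c, hM, hC, hc, hup, hlo⟩ := snow_complex α h0 h1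
  have : Nonempty (Fin M) := ⟨⟨0, hM⟩⟩
  have hup' : ∀ (i : Fin M) x y, ‖F (2 ^ (i:ℕ) * x) - F (2 ^ (i:ℕ) * y)‖
      ≤ C * (2 ^ M) ^ α * |x - y| ^ α := by
    intro i x y
    refine (hup _ _).trans ?_
    rw [← mul_sub, abs_mul, mul_assoc, ← Real.mul_rpow (by positivity) (by positivity)]
    rw [abs_of_pos (by positivity : (0:ℝ) < 2 ^ (i:ℕ))]
    have : (2:ℝ) ^ (i:ℕ) ≤ 2 ^ M := pow_le_pow_right₀ (by norm_num) i.2.le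
    gcongr
  refine ⟨Fin M ⊕ Fin M, inferInstance, inferInstance,
    Sum.elim (fun i x => (F (2 ^ (i:ℕ) * x) - F 0).re) (fun i x => (F (2 ^ (i:ℕ) * x) - F 0).im),
    C * (2 ^ M) ^ α, c, by positivity, hc, ?_, ?_, ?_⟩
  · rintro (i | i) <;> simp
  · rintro (i | i) x y
    · refine le_trans ?_ (hup' i x y)
      simpa using Complex.abs_re_le_norm (F (2 ^ (i:ℕ) * x) - F (2 ^ (i:ℕ) * y))
    · refine le_trans ?_ (hup' i x y)
      simpa using Complex.abs_im_le_norm (F (2 ^ (i:ℕ) * x) - F (2 ^ (i:ℕ) * y))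
  · intro x y
    rcases eq_or_ne x y with rfl | hne
    · simp [Real.zero_rpow h0.ne']
    have hd : 0 < |x - y| := abs_pos.2 (sub_ne_zero.2 hne)
    obtain ⟨n, hn1, hn2⟩ := exists_mem_Ioc_zpow hd (one_lt_two (α := ℝ))
    set l : ℤ := -(n + 1) with hl
    have hMz : (0:ℤ) < M := by exact_mod_cast hM
    obtain ⟨i, hi⟩ : ∃ i : ℕ, (i : ℤ) = l % M :=
      ⟨(l % M).toNat, Int.toNat_of_nonneg (Int.emod_nonneg _ hMz.ne')⟩
    have hiM : i < M := by
      have := Int.emod_lt_of_pos l hMz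
      omega
    have hp : |(2:ℝ) ^ i * x - 2 ^ i * y| * ((2:ℝ) ^ M) ^ (l / M) = |x - y| * 2 ^ l := by
      rw [← mul_sub, abs_mul, abs_of_pos (by positivity : (0:ℝ) < 2 ^ i)]
      have : (2:ℝ) ^ l = 2 ^ i * ((2:ℝ) ^ M) ^ (l / M) := by
        rw [← zpow_natCast, ← zpow_natCast, ← zpow_mul, ← zpow_add₀ (by norm_num), hi,
          Int.emod_add_mul_ediv]
      rw [this]; ring
    have hp1 : |x - y| * (2:ℝ) ^ l ≤ 1 := by
      rw [hl, zpow_neg, ← div_eq_mul_inv]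
      exact div_le_one_of_le₀ hn2 (by positivity)
    have hp2 : 1 / 2 ≤ |x - y| * (2:ℝ) ^ l := by
      rw [hl, zpow_neg, ← div_eq_mul_inv, le_div_iff₀ (by positivity), zpow_add_one₀ (by norm_num)]
      linarith
    have hk := hlo (2 ^ i * x) (2 ^ i * y) (l / M) (hp ▸ hp1) (hp ▸ hp2)
    have hk2 : c * |x - y| ^ α ≤ ‖F (2 ^ i * x) - F (2 ^ i * y)‖ := by
      refine le_trans ?_ hk
      rw [← mul_sub, abs_mul, abs_of_pos (by positivity : (0:ℝ) < 2 ^ i)]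
      have : (1:ℝ) ≤ 2 ^ i := one_le_pow₀ (by norm_num)
      gcongr
      nlinarith
    refine hk2.trans ((Complex.norm_le_abs_re_add_abs_im _).trans ?_)
    rw [Fintype.sum_sum_type]
    have e1 := Finset.single_le_sum (f := fun j : Fin M =>
      |(F (2 ^ (j:ℕ) * x) - F (2 ^ (j:ℕ) * y)).re|) (fun _ _ => abs_nonneg _)
      (Finset.mem_univ ⟨i, hiM⟩)
    have e2 := Finset.single_le_sum (f := fun j : Fin M =>
      |(F (2 ^ (j:ℕ) * x) - F (2 ^ (j:ℕ) * y)).im|) (fun _ _ => abs_nonneg _)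
      (Finset.mem_univ ⟨i, hiM⟩)
    simp only [Sum.elim_inl, Sum.elim_inr, Complex.sub_re, Complex.sub_im, sub_sub_sub_cancel_right]
      at e1 e2 ⊢
    exact add_le_add e1 e2

end weier

lemma reducible_of_maps {X Y ι : Type} [NormedAddCommGroup X] [NormedAddCommGroup Y]
    [MeasurableSpace X] [BorelSpace X] [MeasurableSpace Y] [BorelSpace Y]
    [Fintype ι] [Nonempty ι] (p q α C c : ℝ) (hα : 0 < α) (hq : 0 < q) (hpq : α * q = p)
    (hC : 0 ≤ C) (hc : 0 < c) (Φ : ι → X → Y)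
    (hup : ∀ i f g, ‖Φ i f - Φ i g‖ ≤ C * ‖f - g‖ ^ α)
    (hlo : ∀ f g, c * ‖f - g‖ ^ α ≤ ∑ i, ‖Φ i f - Φ i g‖) :
    BorelReducible (ESum X p) (ESum Y q) := by
  obtain ⟨e⟩ : Nonempty (ℕ ≃ ℕ × ι) := nonempty_equiv_of_countable
  refine ⟨fun x n => Φ (e n).2 (x (e n).1), ?_, ?_⟩
  · refine measurable_pi_lambda _ fun n => ?_
    have hcont : Continuous (Φ (e n).2) := by
      rw [continuous_iff_continuousAt]
      intro g
      rw [ContinuousAt, tendsto_iff_norm_sub_tendsto_zero]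
      refine squeeze_zero (fun _ => norm_nonneg _) (fun f => hup _ f g) ?_
      have : Continuous fun f : X => C * ‖f - g‖ ^ α :=
        continuous_const.mul ((continuous_id.sub continuous_const).norm.rpow_const
          fun _ => Or.inr hα.le)
      simpa [Real.zero_rpow hα.ne'] using this.tendsto g
    exact hcont.measurable.comp (measurable_pi_apply _)
  · intro x y
    unfold ESum
    have hpw : ∀ m, (‖x m - y m‖ ^ α) ^ q = ‖x m - y m‖ ^ p := fun m => by
      rw [← Real.rpow_mul (norm_nonneg _), hpq]
    have h1 : (Summable fun n => ‖Φ (e n).2 (x (e n).1) - Φ (e n).2 (y (e n).1)‖ ^ q) ↔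
        Summable fun m => ∑ i, ‖Φ i (x m) - Φ i (y m)‖ ^ q := by
      rw [show (fun n => ‖Φ (e n).2 (x (e n).1) - Φ (e n).2 (y (e n).1)‖ ^ q) =
        (fun z : ℕ × ι => ‖Φ z.2 (x z.1) - Φ z.2 (y z.1)‖ ^ q) ∘ e from rfl,
        e.summable_iff, summable_prod_of_nonneg (fun z => by positivity)]
      simp only [tsum_fintype]
      exact ⟨fun h => h.2, fun h => ⟨fun m => (hasSum_fintype _).summable, h⟩⟩
    rw [h1]
    constructor
    · intro h
      refine Summable.of_nonneg_of_le (fun m => by positivity) (fun m => ?_)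
        (h.mul_left (Fintype.card ι * C ^ q))
      calc _ ≤ ∑ i : ι, C ^ q * ‖x m - y m‖ ^ p := by
            refine Finset.sum_le_sum fun i _ => ?_
            rw [← hpw, ← Real.mul_rpow hC (by positivity)]
            exact Real.rpow_le_rpow (norm_nonneg _) (hup _ _ _) hq.le
        _ = _ := by simp; ring
    · intro h
      have hN : (0:ℝ) < Fintype.card ι := by exact_mod_cast Fintype.card_pos
      have hcN : 0 < (c / Fintype.card ι) ^ q := by positivity
      rw [← summable_mul_left_iff hcN.ne']
      refine Summable.of_nonneg_of_le (fun m => by positivity) (fun m => ?_) h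
      obtain ⟨i, hi⟩ : ∃ i, c / Fintype.card ι * ‖x m - y m‖ ^ α ≤ ‖Φ i (x m) - Φ i (y m)‖ := by
        by_contra! hcon
        have := Finset.sum_lt_sum_of_nonempty (Finset.univ_nonempty (α := ι))
          fun i _ => hcon i
        have h2 := hlo (x m) (y m)
        simp only [Finset.sum_const, Finset.card_univ, nsmul_eq_mul] at this
        have h3 : (Fintype.card ι : ℝ) * (c / Fintype.card ι * ‖x m - y m‖ ^ α)
          = c * ‖x m - y m‖ ^ α := by field_simp
        linarith
      rw [← hpw, ← Real.mul_rpow (by positivity) (by positivity)]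
      refine (Real.rpow_le_rpow (by positivity) hi hq.le).trans ?_
      exact Finset.single_le_sum (f := fun i => ‖Φ i (x m) - Φ i (y m)‖ ^ q)
        (fun i _ => by positivity) (Finset.mem_univ i)

section Lpp
variable {Ω : Type*} [MeasurableSpace Ω] {μ : Measure Ω}

lemma core_upper (r s α C : ℝ) (hα : 0 < α) (hs : 0 ≤ s) (hr : s * α = r) (f h : Ω → ℝ)
    (hb : ∀ᵐ x ∂μ, |h x| ≤ C * |f x| ^ α) :
    eLpNorm h (ENNReal.ofReal s) μ ≤
      ENNReal.ofReal C * eLpNorm f (ENNReal.ofReal r) μ ^ α := by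
  have h1 := eLpNorm_norm_rpow (μ := μ) (p := ENNReal.ofReal s) f hα
  rw [← ENNReal.ofReal_mul hs, hr] at h1
  rw [← h1]
  refine eLpNorm_le_mul_eLpNorm_of_ae_le_mul ?_ _
  filter_upwards [hb] with x hx
  rw [Real.norm_eq_abs, Real.norm_eq_abs, Real.norm_eq_abs, abs_of_nonneg (a := |f x| ^ α) (by positivity)]
  exact hx

lemma core_lower {ι : Type} [Fintype ι] (r s α c : ℝ) (hα : 0 < α) (hs : 1 ≤ s)
    (hr : s * α = r) (hc : 0 < c) (f : Ω → ℝ) (h : ι → Ω → ℝ)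
    (hm : ∀ i, AEStronglyMeasurable (h i) μ)
    (hb : ∀ᵐ x ∂μ, c * |f x| ^ α ≤ ∑ i, |h i x|) :
    ENNReal.ofReal c * eLpNorm f (ENNReal.ofReal r) μ ^ α ≤
      ∑ i, eLpNorm (h i) (ENNReal.ofReal s) μ := by
  have h1 := eLpNorm_norm_rpow (μ := μ) (p := ENNReal.ofReal s) f hα
  rw [← ENNReal.ofReal_mul (by linarith), hr] at h1
  rw [← h1]
  have h2 := eLpNorm_sum_le (μ := μ) (p := ENNReal.ofReal s) (s := Finset.univ)
    (f := fun i x => ‖h i x‖) (fun i _ => (hm i).norm) (ENNReal.one_le_ofReal.2 hs)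
  simp only [eLpNorm_norm] at h2
  refine le_trans ?_ h2
  have h3 := eLpNorm_const_smul (μ := μ) (p := ENNReal.ofReal s) c (fun x => ‖f x‖ ^ α)
  rw [Real.enorm_eq_ofReal hc.le] at h3
  rw [← h3]
  refine eLpNorm_mono_ae ?_
  filter_upwards [hb] with x hx
  simp only [Pi.smul_apply, smul_eq_mul, Finset.sum_apply, Real.norm_eq_abs]
  rw [abs_of_nonneg (a := c * |f x| ^ α) (by positivity)]
  exact hx.trans (le_abs_self _)

/-- Norm version for spaces whose norm is an `eLpNorm`. -/
lemma reducible_core {X Y : Type} [NormedAddCommGroup X] [NormedAddCommGroup Y]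
    [MeasurableSpace X] [BorelSpace X] [MeasurableSpace Y] [BorelSpace Y]
    (r s p q : ℝ) (hr : 1 ≤ r) (hs : 1 ≤ s) (hp : 1 ≤ p)
    (hq : 1 ≤ q) (hratio : r / p = s / q) (hpq : p ≤ q)
    (jX : X → Ω → ℝ) (jY : Y → Ω → ℝ)
    (hX : ∀ f, MemLp (jX f) (ENNReal.ofReal r) μ)
    (hY : ∀ f, MemLp (jY f) (ENNReal.ofReal s) μ)
    (nX : ∀ f g, ‖f - g‖ = (eLpNorm (jX f - jX g) (ENNReal.ofReal r) μ).toReal)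
    (nY : ∀ f g, ‖f - g‖ = (eLpNorm (jY f - jY g) (ENNReal.ofReal s) μ).toReal)
    (sY : ∀ h, MemLp h (ENNReal.ofReal s) μ → ∃ f, jY f =ᵐ[μ] h) :
    BorelReducible (ESum X p) (ESum Y q) := by
  obtain ⟨α, hα⟩ : ∃ α, α = p / q := ⟨_, rfl⟩
  have hα0 : 0 < α := by rw [hα]; positivity
  have hα1 : α ≤ 1 := by rw [hα]; exact div_le_one_of_le₀ hpq (by linarith)
  have hαq : α * q = p := by rw [hα]; field_simp
  have hsα : s * α = r := by
    rw [hα]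
    rw [div_eq_div_iff (by positivity) (by positivity)] at hratio
    field_simp; linarith
  obtain ⟨ι, _, _, φ, C, c, hC, hc, hφ0, hup, hlo⟩ := snow α hα0 hα1
  have hφc : ∀ i, Continuous (φ i) := by
    intro i
    rw [continuous_iff_continuousAt]
    intro g
    rw [ContinuousAt, tendsto_iff_norm_sub_tendsto_zero]
    refine squeeze_zero (fun _ => norm_nonneg _) (fun f => hup _ f g) ?_
    have : Continuous fun f : ℝ => C * |f - g| ^ α :=
      continuous_const.mul ((continuous_id.sub continuous_const).abs.rpow_const
        fun _ => Or.inr hα0.le)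
    simpa [Real.zero_rpow hα0.ne'] using this.tendsto g
  have hmem : ∀ i f, MemLp (fun x => φ i (jX f x)) (ENNReal.ofReal s) μ := by
    intro i f
    refine ⟨(hφc i).comp_aestronglyMeasurable (hX f).1, ?_⟩
    refine (core_upper r s α C hα0 (by linarith) hsα (jX f) _ (ae_of_all _ fun x => ?_)).trans_lt ?_
    · simpa [hφ0] using hup i (jX f x) 0
    · exact ENNReal.mul_lt_top ENNReal.ofReal_lt_top
        (ENNReal.rpow_lt_top_of_nonneg hα0.le (hX f).2.ne)
  choose Φ hΦ using fun i f => sY _ (hmem i f)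
  refine reducible_of_maps p q α C c hα0 (by linarith) hαq hC hc Φ ?_ ?_
  · intro i f g
    rw [nX, nY, ENNReal.toReal_rpow, ← ENNReal.toReal_ofReal hC, ← ENNReal.toReal_mul]
    refine ENNReal.toReal_mono (ENNReal.mul_ne_top ENNReal.ofReal_ne_top
      (ENNReal.rpow_ne_top_of_nonneg hα0.le ((hX f).sub (hX g)).2.ne)) ?_
    refine core_upper r s α C hα0 (by linarith) hsα _ _ ?_
    filter_upwards [hΦ i f, hΦ i g] with x h1 h2
    rw [Pi.sub_apply, Pi.sub_apply, h1, h2]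
    exact hup _ _ _
  · intro f g
    simp only [nX, nY]
    rw [ENNReal.toReal_rpow, ← ENNReal.toReal_sum fun i _ => ((hY _).sub (hY _)).2.ne]
    nth_rewrite 1 [← ENNReal.toReal_ofReal hc.le]
    rw [← ENNReal.toReal_mul]
    refine ENNReal.toReal_mono (ENNReal.sum_ne_top.2 fun i _ => ((hY _).sub (hY _)).2.ne) ?_
    refine core_lower r s α c hα0 hs hsα hc _ _ (fun i => ((hY _).sub (hY _)).1) ?_
    filter_upwards [ae_all_iff.2 fun i => hΦ i f, ae_all_iff.2 fun i => hΦ i g] with x h1 h2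
    simp only [Pi.sub_apply, h1, h2]
    exact hlo _ _

end Lpp

lemma lp_eLpNorm (r : ℝ) (hr : 1 ≤ r) (f : ℕ → ℝ) :
    eLpNorm f (ENNReal.ofReal r) Measure.count =
      (∑' n, ENNReal.ofReal (‖f n‖ ^ r)) ^ (1 / r) := by
  rw [eLpNorm_eq_lintegral_rpow_enorm_toReal (by simp; linarith) ENNReal.ofReal_ne_top,
    ENNReal.toReal_ofReal (by linarith), lintegral_count]
  congr 2; ext n
  rw [← ofReal_norm, ENNReal.ofReal_rpow_of_nonneg (norm_nonneg _) (by linarith)]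

lemma lp_mem (r : ℝ) (hr : 1 ≤ r) (f : ℕ → ℝ) :
    MemLp f (ENNReal.ofReal r) Measure.count ↔ Memℓp f (ENNReal.ofReal r) := by
  rw [memℓp_gen_iff (by rw [ENNReal.toReal_ofReal] <;> linarith),
    ENNReal.toReal_ofReal (by linarith), MemLp, lp_eLpNorm r hr]
  have hr' : 0 < 1 / r := by positivity
  rw [ENNReal.rpow_lt_top_iff_of_pos hr']
  constructor
  · rintro ⟨-, h⟩
    have := ENNReal.summable_toReal h.ne
    refine this.congr fun n => ?_
    rw [ENNReal.toReal_ofReal (by positivity)]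
  · intro h
    refine ⟨(measurable_of_countable f).aestronglyMeasurable, ?_⟩
    exact h.tsum_ofReal_lt_top

lemma lp_norm (r : ℝ) (hr : 1 ≤ r) (f : ellSp r) :
    ‖f‖ = (eLpNorm (f : ℕ → ℝ) (ENNReal.ofReal r) Measure.count).toReal := by
  rw [lp.norm_eq_tsum_rpow (by rw [ENNReal.toReal_ofReal] <;> linarith), lp_eLpNorm r hr,
    ENNReal.toReal_ofReal (by linarith), ← ENNReal.toReal_rpow, ENNReal.tsum_toReal_eq (by simp)]
  congr 2; ext n
  rw [ENNReal.toReal_ofReal (by positivity)]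

theorem reducible_of_ratio_eq (r s p q : ℝ) (hr : 1 ≤ r) (hs : 1 ≤ s) (hp : 1 ≤ p)
    (hq : 1 ≤ q) (hratio : r / p = s / q) (hpq : p ≤ q)
    [Fact (1 ≤ ENNReal.ofReal r)] [Fact (1 ≤ ENNReal.ofReal s)] :
    BorelReducible (ESum (ellSp r) p) (ESum (ellSp s) q) ∧
    BorelReducible (ESum (LSp r) p) (ESum (LSp s) q) := by
  constructor
  · refine reducible_core (μ := (Measure.count : Measure ℕ)) r s p q hr hs hp hq hratio hpq
      (fun f => (f : ℕ → ℝ)) (fun f => (f : ℕ → ℝ)) (fun f => (lp_mem r hr _).2 (lp.memℓp f))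
      (fun f => (lp_mem s hs _).2 (lp.memℓp f)) ?_ ?_ ?_
    · intro f g
      rw [lp_norm r hr, lp.coeFn_sub]
    · intro f g
      rw [lp_norm s hs, lp.coeFn_sub]
    · intro h hh
      exact ⟨⟨h, (lp_mem s hs _).1 hh⟩, Filter.EventuallyEq.rfl⟩
  · refine reducible_core (μ := (volume : Measure ℝ).restrict (Set.Icc 0 1))
      r s p q hr hs hp hq hratio hpq
      (fun f => (f : ℝ → ℝ)) (fun f => (f : ℝ → ℝ)) (fun f => Lp.memLp f)
      (fun f => Lp.memLp f) ?_ ?_ ?_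
    · intro f g
      rw [Lp.norm_def, eLpNorm_congr_ae (Lp.coeFn_sub f g)]
    · intro f g
      rw [Lp.norm_def, eLpNorm_congr_ae (Lp.coeFn_sub f g)]
    · intro h hh
      exact ⟨hh.toLp h, hh.coeFn_toLp⟩
end
end
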